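/- (Sanov theorem for quantum Markov chains.) Suppose the transition operator T is primitive and ψ ∈ ℂ^d is a unit vector, and let m ≥ 1. Define the rate function I : ℝ^{k^m} → [0,∞] by I(x) = sup_{t ∈ ℝ^{k^m}} ( ⟨t, x⟩ − log r(T̃_{t,m}) ). Then the level-m empirical measure P̂_n^{(m)} satisfies a large deviation principle with rate function I: for every Borel set B ⊆ ℝ^{k^m}, −inf_{x ∈ int(B)} I(x) ≤ liminf_{n→∞} (1/n) log P( P̂_n^{(m)} ∈ B ) ≤ limsup_{n→∞} (1/n) log P( P̂_n^{(m)} ∈ B ) ≤ −inf_{x ∈ cl(B)} I(x). -/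

import Mathlib

open Matrix Finset
open scoped ComplexOrder Classical

/-- Product `V_{i_n} ⋯ V_{i_1}` of Kraus operators along a word `(i_1, …, i_n)`. -/
noncomputable def prodRev {d k n : ℕ} (V : Fin k → Matrix (Fin d) (Fin d) ℂ)
    (i : Fin n → Fin k) : Matrix (Fin d) (Fin d) ℂ :=
  ((List.ofFn i).reverse.map V).prod

/-- The transition operator `T(A) = ∑ᵢ Vᵢ* A Vᵢ` of the quantum Markov chain. -/
noncomputable def Tmap {d k : ℕ} (V : Fin k → Matrix (Fin d) (Fin d) ℂ)
    (A : Matrix (Fin d) (Fin d) ℂ) : Matrix (Fin d) (Fin d) ℂ :=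
  ∑ i : Fin k, (V i)ᴴ * A * V i

/-- Probability `P(X⁽¹⁾ = i₁, …, X⁽ⁿ⁾ = iₙ) = ‖V_{iₙ} ⋯ V_{i₁} ψ‖²` of an output trajectory. -/
noncomputable def outProb {d k n : ℕ} (V : Fin k → Matrix (Fin d) (Fin d) ℂ)
    (ψ : Fin d → ℂ) (i : Fin n → Fin k) : ℝ :=
  ∑ x : Fin d, ‖(prodRev V i *ᵥ ψ) x‖ ^ 2

/-- The extended transition operator `T_{t,m}` (with `m = m' + 1`). -/
noncomputable def extT {d k m' : ℕ} (V : Fin k → Matrix (Fin d) (Fin d) ℂ)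
    (t : (Fin (m' + 1) → Fin k) → ℝ)
    (Y : (Fin m' → Fin k) → Matrix (Fin d) (Fin d) ℂ) :
    (Fin m' → Fin k) → Matrix (Fin d) (Fin d) ℂ :=
  fun w => ∑ j : Fin k,
    (Real.exp (t (Fin.snoc w j)) : ℂ) •
      ((V ((Fin.snoc w j : Fin (m' + 1) → Fin k) 0))ᴴ *
        Y (Fin.tail (Fin.snoc w j : Fin (m' + 1) → Fin k)) *
        V ((Fin.snoc w j : Fin (m' + 1) → Fin k) 0))

/-- `M^{(m)}`, with `[M^{(m)}]_{i_1,…,i_{m-1}} = (V_{i_{m-1}} ⋯ V_{i_1})* (V_{i_{m-1}} ⋯ V_{i_1})`. -/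
noncomputable def Mmat {d k m' : ℕ} (V : Fin k → Matrix (Fin d) (Fin d) ℂ) :
    (Fin m' → Fin k) → Matrix (Fin d) (Fin d) ℂ :=
  fun w => (prodRev V w)ᴴ * prodRev V w

/-- The subspace `B_m = { Y : Y_w = Q_w Y_w Q_w for all words w }`. -/
noncomputable def Bsub {d k m' : ℕ} (Q : (Fin m' → Fin k) → Matrix (Fin d) (Fin d) ℂ) :
    Submodule ℂ ((Fin m' → Fin k) → Matrix (Fin d) (Fin d) ℂ) where
  carrier := {Y | ∀ w, Y w = Q w * Y w * Q w}
  add_mem' := by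
    intro a b ha hb w
    simp only [Pi.add_apply]
    rw [Matrix.mul_add, Matrix.add_mul, ← ha w, ← hb w]
  zero_mem' := by intro w; simp
  smul_mem' := by
    intro c a ha w
    simp only [Pi.smul_apply]
    rw [Matrix.mul_smul, Matrix.smul_mul, ← ha w]

/-- The level-`m` empirical measure `P̂ₙ⁽ᵐ⁾ ∈ ℝ^{kᵐ}` of an output trajectory `i` of length `n`
(with `m = m' + 1`, so the number of windows is `n - m + 1 = n - m'`):
`P̂ₙ⁽ᵐ⁾(w) = (n - m + 1)⁻¹ ∑_j 1[(X⁽ʲ⁾, …, X⁽ʲ⁺ᵐ⁻¹⁾) = w]`. -/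
noncomputable def empMeas {k m' : ℕ} (n : ℕ) (i : Fin n → Fin k) :
    (Fin (m' + 1) → Fin k) → ℝ :=
  fun w => ((n - m' : ℕ) : ℝ)⁻¹ * ∑ j : Fin (n - m'),
    if (fun l : Fin (m' + 1) => i ⟨j.1 + l.1, by have hj := j.2; have hl := l.2; omega⟩) = w
    then 1 else 0

/-- The probability `P(P̂ₙ⁽ᵐ⁾ ∈ B)` that the level-`m` empirical measure of the length-`n`
output trajectory lies in a set `B ⊆ ℝ^{kᵐ}`. -/
noncomputable def empProb {d k m' : ℕ} (V : Fin k → Matrix (Fin d) (Fin d) ℂ)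
    (ψ : Fin d → ℂ) (n : ℕ) (B : Set ((Fin (m' + 1) → Fin k) → ℝ)) : ℝ :=
  ∑ i : Fin n → Fin k, if empMeas (m' := m') n i ∈ B then outProb V ψ i else 0

/-- A family of masses `F n x r`, thought of as the probability that a sum of `n` increments is
within `r` of `x`, which is supermultiplicative up to bounded gaps. -/
structure IsSupermultiplicative {E : Type*} [NormedAddCommGroup E]
    (F : ℕ → E → ℝ → ℝ) (c : ℝ) (N : ℕ) (K : ℝ) : Prop where
  c_pos : 0 < c
  c_le_one : c ≤ 1
  K_nonneg : 0 ≤ K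
  nonneg : ∀ n x r, 0 ≤ F n x r
  le_one : ∀ n x r, F n x r ≤ 1
  one_le_zero : ∀ n : ℕ, 1 ≤ F n 0 n
  le_of_near : ∀ n x y r s, r + ‖x - y‖ ≤ s → F n x r ≤ F n y s
  mul_le : ∀ a b x y r s, c * F a x r * F b y s ≤ F (a + N + b) (x + y) (r + s + K)

/-- The pairs `(y, s)` such that the mass near `n • y` decays at rate at most `s`, along the
filter `l` being all large `n`. -/
def rateSet {E : Type*} [NormedAddCommGroup E] [NormedSpace ℝ E] (F : ℕ → E → ℝ → ℝ) :
    Set (E × ℝ) :=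
  {z | ∀ δ > 0, ∀ ε > 0, ∀ᶠ n : ℕ in Filter.atTop,
    Real.exp (-(n * (z.2 + ε))) ≤ F n ((n : ℝ) • z.1) (n * δ)}

section Supermultiplicative

variable {E : Type*} [NormedAddCommGroup E] [NormedSpace ℝ E]
  {F : ℕ → E → ℝ → ℝ} {c K : ℝ} {N : ℕ}

theorem IsSupermultiplicative.pow_le (h : IsSupermultiplicative F c N K) (l ρ : ℕ) (x : E) (r : ℝ)
    (q : ℕ) :
    (c * F l x r) ^ q ≤ F (q * (l + N) + ρ) ((q : ℝ) • x) (q * (r + K) + ρ) := by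
  induction q with
  | zero => simpa using h.one_le_zero ρ
  | succ q ih =>
    have h1 := h.mul_le l (q * (l + N) + ρ) x ((q : ℝ) • x) r (q * (r + K) + ρ)
    have e1 : l + N + (q * (l + N) + ρ) = (q + 1) * (l + N) + ρ := by ring
    have e2 : x + (q : ℝ) • x = ((q + 1 : ℕ) : ℝ) • x := by
      push_cast; rw [add_smul, one_smul, add_comm]
    have e3 : r + (q * (r + K) + ρ) + K = ((q + 1 : ℕ) : ℝ) * (r + K) + ρ := by
      push_cast; ring
    rw [e1, e2, e3] at h1
    refine le_trans ?_ h1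
    rw [pow_succ, mul_comm]
    exact mul_le_mul_of_nonneg_left ih (mul_nonneg h.c_pos.le (h.nonneg _ _ _))

theorem IsSupermultiplicative.rate_nonneg (h : IsSupermultiplicative F c N K) {y : E} {s : ℝ}
    (hz : ∀ δ > 0, ∀ ε > 0, ∃ᶠ n : ℕ in Filter.atTop,
      Real.exp (-(n * (s + ε))) ≤ F n ((n : ℝ) • y) (n * δ)) : 0 ≤ s := by
  refine le_of_forall_pos_le_add fun ε hε => ?_
  obtain ⟨n, hn, hn1⟩ := ((hz 1 one_pos ε hε).and_eventually
    (Filter.eventually_ge_atTop 1)).exists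
  have h1 := hn.trans (h.le_one _ _ _)
  rw [Real.exp_le_one_iff] at h1
  have : (0 : ℝ) < n := by exact_mod_cast hn1
  nlinarith

theorem IsSupermultiplicative.mem_rateSet_of_frequently (h : IsSupermultiplicative F c N K) {y : E}
    {s : ℝ}
    (hz : ∀ δ > 0, ∀ ε > 0, ∃ᶠ n : ℕ in Filter.atTop,
      Real.exp (-(n * (s + ε))) ≤ F n ((n : ℝ) • y) (n * δ)) : (y, s) ∈ rateSet F := by
  intro δ hδ ε hε
  have hs := h.rate_nonneg hz
  obtain ⟨l, hl, hl0, hl1, hl2⟩ := ((hz (δ / 4) (by positivity) (ε / 2) (by positivity)).and_eventually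
    ((Filter.eventually_ge_atTop 1).and
    ((tendsto_natCast_atTop_atTop.eventually_ge_atTop (4 * (K + N * ‖y‖) / δ)).and
    (tendsto_natCast_atTop_atTop.eventually_ge_atTop (2 * (-Real.log c) / ε))))).exists
  have hlr : (0 : ℝ) < l := by exact_mod_cast hl0
  rw [div_le_iff₀ hδ] at hl1
  rw [div_le_iff₀ hε] at hl2
  filter_upwards [tendsto_natCast_atTop_atTop.eventually_ge_atTop
    (4 * ((l + N : ℕ) * (1 + ‖y‖)) / δ)] with n hn
  rw [div_le_iff₀ hδ] at hn
  set q := n / (l + N) with hq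
  set ρ := n % (l + N) with hρ
  have hnq : q * (l + N) + ρ = n := by rw [mul_comm]; exact Nat.div_add_mod _ _
  have hρlt : ρ ≤ l + N := (Nat.mod_lt _ (by omega)).le
  have hnq' : (q : ℝ) * (l + N) + ρ = n := by exact_mod_cast hnq
  have hρlt' : (ρ : ℝ) ≤ ((l + N : ℕ) : ℝ) := by exact_mod_cast hρlt
  have hq0 : (0 : ℝ) ≤ q := by positivity
  have hρ0 : (0 : ℝ) ≤ ρ := by positivity
  have hN0 : (0 : ℝ) ≤ N := by positivity
  have hy0 := norm_nonneg y
  have hql : (q : ℝ) * l ≤ n := by nlinarith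
  have hp := h.pow_le l ρ ((l : ℝ) • y) (l * (δ / 4)) q
  rw [hnq] at hp
  have hlog : 0 ≤ - Real.log c := by
    have := Real.log_nonpos h.c_pos.le h.c_le_one; linarith
  calc Real.exp (-(n * (s + ε)))
      ≤ (c * Real.exp (-(l * (s + ε / 2)))) ^ q := by
        nth_rw 1 [← Real.exp_log h.c_pos]
        rw [← Real.exp_add, ← Real.exp_nat_mul]
        apply Real.exp_le_exp.mpr
        have h1 : (q : ℝ) * l * (s + ε / 2) ≤ n * (s + ε / 2) :=
          mul_le_mul_of_nonneg_right hql (by positivity)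
        have h2 : q * (-Real.log c) ≤ n * (ε / 2) := by
          have : q * (2 * (-Real.log c)) ≤ q * (l * ε) := mul_le_mul_of_nonneg_left hl2 hq0
          nlinarith
        nlinarith
    _ ≤ (c * F l ((l : ℝ) • y) (l * (δ / 4))) ^ q :=
        pow_le_pow_left₀ (mul_nonneg h.c_pos.le (Real.exp_pos _).le)
          (mul_le_mul_of_nonneg_left hl h.c_pos.le) _
    _ ≤ _ := hp
    _ ≤ _ := by
        apply h.le_of_near
        have h3 : ‖(q : ℝ) • (l : ℝ) • y - (n : ℝ) • y‖ = (q * N + ρ) * ‖y‖ := by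
          rw [smul_smul, ← sub_smul, norm_smul, ← hnq',
            show (q : ℝ) * l - (q * (l + N) + ρ) = -(q * N + ρ) by ring, norm_neg,
            Real.norm_of_nonneg (by positivity)]
        rw [h3]
        have h4 : q * (4 * (K + N * ‖y‖)) ≤ q * (l * δ) := mul_le_mul_of_nonneg_left hl1 hq0
        have h5 : q * l * δ ≤ n * δ := mul_le_mul_of_nonneg_right hql hδ.le
        have h6 : (ρ : ℝ) * (1 + ‖y‖) ≤ ((l + N : ℕ) : ℝ) * (1 + ‖y‖) :=
          mul_le_mul_of_nonneg_right hρlt' (by positivity)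
        nlinarith

theorem IsSupermultiplicative.convex_rateSet (h : IsSupermultiplicative F c N K) :
    Convex ℝ (rateSet F) := by
  rw [convex_iff_forall_pos]
  rintro ⟨y₁, s₁⟩ h₁ ⟨y₂, s₂⟩ h₂ a b ha hb hab
  have hs₁ := h.rate_nonneg fun δ hδ ε hε => (h₁ δ hδ ε hε).frequently
  have hs₂ := h.rate_nonneg fun δ hδ ε hε => (h₂ δ hδ ε hε).frequently
  refine h.mem_rateSet_of_frequently (y := a • y₁ + b • y₂) (s := a * s₁ + b * s₂) ?_
  intro δ hδ ε hε
  set f : ℕ → ℕ := fun j => ⌊a * j⌋₊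
  set g : ℕ → ℕ := fun j => ⌊b * j⌋₊
  have hf : Filter.Tendsto f Filter.atTop Filter.atTop :=
    tendsto_nat_floor_atTop.comp (tendsto_natCast_atTop_atTop.const_mul_atTop ha)
  have hg : Filter.Tendsto g Filter.atTop Filter.atTop :=
    tendsto_nat_floor_atTop.comp (tendsto_natCast_atTop_atTop.const_mul_atTop hb)
  have hfg : Filter.Tendsto (fun j => f j + N + g j) Filter.atTop Filter.atTop :=
    Filter.tendsto_atTop_mono (fun _ => Nat.le_add_left _ _) hg
  apply hfg.frequently
  apply Filter.Eventually.frequently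
  set D : ℝ := K + (N + 2) * (‖y₁‖ + ‖y₂‖) with hD
  have hR : Filter.Tendsto (fun j => ((f j + N + g j : ℕ) : ℝ)) Filter.atTop Filter.atTop :=
    tendsto_natCast_atTop_atTop.comp hfg
  filter_upwards [hf.eventually (h₁ (δ / 2) (by positivity) (ε / 2) (by positivity)),
    hg.eventually (h₂ (δ / 2) (by positivity) (ε / 2) (by positivity)),
    hR.eventually_ge_atTop (2 * D / δ),
    hR.eventually_ge_atTop (2 * (-Real.log c + s₁ + s₂) / ε)] with j hj1 hj2 hj3 hj4
  rw [div_le_iff₀ hδ] at hj3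
  rw [div_le_iff₀ hε] at hj4
  have hu1 : (f j : ℝ) ≤ a * j := Nat.floor_le (by positivity)
  have hu2 : a * j < f j + 1 := Nat.lt_floor_add_one _
  have hv1 : (g j : ℝ) ≤ b * j := Nat.floor_le (by positivity)
  have hv2 : b * j < g j + 1 := Nat.lt_floor_add_one _
  set u := f j
  set v := g j
  push_cast at hj3 hj4 ⊢
  have hN0 : (0 : ℝ) ≤ N := by positivity
  have ha1 : a ≤ 1 := by linarith
  have hb1 : b ≤ 1 := by linarith
  have hu3 := mul_le_mul_of_nonneg_left hu1 hb.le
  have hu4 := mul_le_mul_of_nonneg_left hu2.le hb.le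
  have hv3 := mul_le_mul_of_nonneg_left hv1 ha.le
  have hv4 := mul_le_mul_of_nonneg_left hv2.le ha.le
  have hNa := mul_le_mul_of_nonneg_left ha1 hN0
  have hNb := mul_le_mul_of_nonneg_left hb1 hN0
  have hNa0 := mul_nonneg hN0 ha.le
  have hNb0 := mul_nonneg hN0 hb.le
  have hab' : b = 1 - a := by linarith
  have eu : (u : ℝ) - (u + N + v) * a = b * u - a * v - N * a := by rw [hab']; ring
  have ev : (v : ℝ) - (u + N + v) * b = a * v - b * u - N * b := by rw [hab']; ring
  have hjj : b * (a * j) = a * (b * j) := by ring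
  have hA1 : |(u : ℝ) - (u + N + v) * a| ≤ N + 2 := by
    rw [abs_le, eu]; constructor <;> linarith
  have hA2 : |(v : ℝ) - (u + N + v) * b| ≤ N + 2 := by
    rw [abs_le, ev]; constructor <;> linarith
  calc Real.exp (-((u + N + v) * (a * s₁ + b * s₂ + ε)))
      ≤ c * Real.exp (-(u * (s₁ + ε / 2))) * Real.exp (-(v * (s₂ + ε / 2))) := by
        nth_rw 1 [← Real.exp_log h.c_pos]
        rw [← Real.exp_add, ← Real.exp_add]
        apply Real.exp_le_exp.mpr
        have e1 : (u : ℝ) - (u + N + v) * a ≤ 1 := by linarith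
        have e2 : (v : ℝ) - (u + N + v) * b ≤ 1 := by linarith
        have e3 := mul_le_mul_of_nonneg_right e1 hs₁
        have e4 := mul_le_mul_of_nonneg_right e2 hs₂
        have e5 : 0 ≤ N * ε := by positivity
        nlinarith
    _ ≤ c * F u ((u : ℝ) • y₁) (u * (δ / 2)) * F v ((v : ℝ) • y₂) (v * (δ / 2)) := by
        have := h.c_pos.le
        have := h.nonneg u ((u : ℝ) • y₁) (u * (δ / 2))
        gcongr
    _ ≤ _ := h.mul_le _ _ _ _ _ _
    _ ≤ _ := by
        apply h.le_of_near
        have e1 : (u : ℝ) • y₁ + (v : ℝ) • y₂ - ((u : ℝ) + N + v) • (a • y₁ + b • y₂)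
          = ((u : ℝ) - (u + N + v) * a) • y₁ + ((v : ℝ) - (u + N + v) * b) • y₂ := by
          module
        have e2 : ‖(u : ℝ) • y₁ + (v : ℝ) • y₂ - ((u : ℝ) + N + v) • (a • y₁ + b • y₂)‖
            ≤ (N + 2) * ‖y₁‖ + (N + 2) * ‖y₂‖ := by
          rw [e1]
          refine (norm_add_le _ _).trans ?_
          rw [norm_smul, norm_smul, Real.norm_eq_abs, Real.norm_eq_abs]
          gcongr
        have e5 : 0 ≤ N * δ := by positivity
        nlinarith

theorem IsSupermultiplicative.isClosed_rateSet (h : IsSupermultiplicative F c N K) :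
    IsClosed (rateSet F) := by
  refine isClosed_of_closure_subset fun z hz δ hδ ε hε => ?_
  obtain ⟨w, hw, hzw⟩ := Metric.mem_closure_iff.mp hz (min (δ / 2) (ε / 2)) (by positivity)
  rw [lt_min_iff, Prod.dist_eq, max_lt_iff, max_lt_iff] at hzw
  filter_upwards [hw (δ / 2) (by positivity) (ε / 2) (by positivity)] with n hn
  have hn0 : (0 : ℝ) ≤ n := by positivity
  have h2 := abs_lt.mp (by simpa [Real.dist_eq] using hzw.2.2)
  refine le_trans ?_ (hn.trans (h.le_of_near _ _ _ _ _ ?_))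
  · apply Real.exp_le_exp.mpr
    nlinarith
  · have h1 := hzw.1.1
    rw [dist_comm, dist_eq_norm] at h1
    rw [← smul_sub, norm_smul, Real.norm_of_nonneg hn0]
    nlinarith

end Supermultiplicative

section LargeDeviations

variable {ι : Type*} [Fintype ι] {Ω : ℕ → Type*} [∀ n, Fintype (Ω n)]
  {p : ∀ n, Ω n → ℝ} {X : ∀ n, Ω n → ι → ℝ}

/-- The mass that the weights `p` give to the event that `X` is within `r` of `x`. -/
noncomputable def nearMass (p : ∀ n, Ω n → ℝ) (X : ∀ n, Ω n → ι → ℝ) (n : ℕ) (x : ι → ℝ)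
    (r : ℝ) : ℝ :=
  ∑ ω, if ‖X n ω - x‖ ≤ r then p n ω else 0

/-- The Laplace transform of `X` under the weights `p`. -/
noncomputable def laplace (p : ∀ n, Ω n → ℝ) (X : ∀ n, Ω n → ι → ℝ) (n : ℕ) (t : ι → ℝ) : ℝ :=
  ∑ ω, p n ω * Real.exp (t ⬝ᵥ X n ω)

theorem abs_dotProduct_le (t x : ι → ℝ) : |t ⬝ᵥ x| ≤ (∑ i, |t i|) * ‖x‖ := by
  rw [dotProduct, Finset.sum_mul]
  refine (Finset.abs_sum_le_sum_abs _ _).trans (Finset.sum_le_sum fun i _ => ?_)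
  rw [abs_mul]
  exact mul_le_mul_of_nonneg_left (norm_le_pi_norm x i) (abs_nonneg _)

theorem le_of_forall_mem_rateSet {c K : ℝ} {N : ℕ} (hp : ∀ n ω, 0 ≤ p n ω)
    (hX : ∀ n ω, ‖X n ω‖ ≤ n)
    (h : IsSupermultiplicative (nearMass p X) c N K) {t : ι → ℝ} {L : ℝ}
    (hL : ∀ ε > 0, ∀ᶠ n : ℕ in Filter.atTop, Real.exp (n * (L - ε)) ≤ laplace p X n t)
    {β : ℝ} (hβ : ∀ z ∈ rateSet (nearMass p X), t ⬝ᵥ z.1 - z.2 ≤ β) : L ≤ β := by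
  by_contra! hlt
  set η := (L - β) / 4 with hη
  have hη0 : 0 < η := by rw [hη]; linarith
  set A : ℝ := ∑ i, |t i| with hA
  have hA0 : 0 ≤ A := Finset.sum_nonneg fun i _ => abs_nonneg _
  have key : ∀ y : ι → ℝ, ∃ δ > 0, A * δ ≤ η ∧ ∀ᶠ n : ℕ in Filter.atTop,
      nearMass p X n ((n : ℝ) • y) (n * δ) ≤ Real.exp (-(n * (t ⬝ᵥ y - β - η))) := by
    intro y
    have hy : (y, t ⬝ᵥ y - β - η) ∉ rateSet (nearMass p X) := fun hmem => by
      have := hβ _ hmem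
      dsimp only at this
      linarith
    have := mt h.mem_rateSet_of_frequently hy
    push Not at this
    obtain ⟨δ, hδ, ε, hε, hn⟩ := this
    refine ⟨min δ (η / (A + 1)), by positivity, ?_, ?_⟩
    · calc A * min δ (η / (A + 1)) ≤ A * (η / (A + 1)) := by gcongr; exact min_le_right _ _
        _ = η * (A / (A + 1)) := by ring
        _ ≤ η * 1 := by gcongr; rw [div_le_one (by positivity)]; linarith
        _ = η := mul_one _
    · filter_upwards [hn] with n hn
      have hn0 : (0 : ℝ) ≤ n := by positivity
      refine (h.le_of_near n _ _ _ (n * δ) ?_).trans (hn.le.trans ?_)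
      · simp only [sub_self, norm_zero, add_zero]
        gcongr
        exact min_le_left _ _
      · apply Real.exp_le_exp.mpr
        nlinarith
  choose δ hδ hAδ hev using key
  obtain ⟨s, -, hs⟩ := (isCompact_closedBall (0 : ι → ℝ) 1).elim_nhds_subcover
    (fun y => Metric.ball y (δ y)) (fun y _ => Metric.ball_mem_nhds y (hδ y))
  have hall : ∀ᶠ n : ℕ in Filter.atTop, ∀ y ∈ s,
      nearMass p X n ((n : ℝ) • y) (n * δ y) ≤ Real.exp (-(n * (t ⬝ᵥ y - β - η))) :=
    (Filter.eventually_all_finset s).mpr fun y _ => hev y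
  have hup : ∀ᶠ n : ℕ in Filter.atTop,
      laplace p X n t ≤ s.card * Real.exp (n * (β + 2 * η)) := by
    filter_upwards [hall, Filter.eventually_ge_atTop 1] with n hn hn1
    have hn0 : (0 : ℝ) < n := by exact_mod_cast hn1
    calc laplace p X n t
        ≤ ∑ ω, ∑ y ∈ s, Real.exp (n * (t ⬝ᵥ y + η)) *
            (if ‖X n ω - (n : ℝ) • y‖ ≤ n * δ y then p n ω else 0) := by
          refine Finset.sum_le_sum fun ω _ => ?_
          have hmem : (n : ℝ)⁻¹ • X n ω ∈ Metric.closedBall (0 : ι → ℝ) 1 := by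
            rw [mem_closedBall_zero_iff, norm_smul, norm_inv, Real.norm_of_nonneg hn0.le]
            rw [inv_mul_le_iff₀ hn0, mul_one]
            exact hX n ω
          obtain ⟨y, hys, hy⟩ := Set.mem_iUnion₂.mp (hs hmem)
          rw [Metric.mem_ball, dist_eq_norm] at hy
          have e : X n ω - (n : ℝ) • y = (n : ℝ) • ((n : ℝ)⁻¹ • X n ω - y) := by
            rw [smul_sub, smul_inv_smul₀ hn0.ne']
          have hy' : ‖X n ω - (n : ℝ) • y‖ ≤ n * δ y := by
            rw [e, norm_smul, Real.norm_of_nonneg hn0.le]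
            gcongr
          refine le_trans ?_ (Finset.single_le_sum (f := fun y => Real.exp (n * (t ⬝ᵥ y + η)) *
            (if ‖X n ω - (n : ℝ) • y‖ ≤ n * δ y then p n ω else 0)) (fun z _ => ?_) hys)
          · rw [if_pos hy', mul_comm]
            refine mul_le_mul_of_nonneg_right (Real.exp_le_exp.mpr ?_) (hp _ _)
            have h1 := (le_abs_self _).trans (abs_dotProduct_le t (X n ω - (n : ℝ) • y))
            rw [dotProduct_sub, dotProduct_smul, smul_eq_mul] at h1
            have h2 : A * ‖X n ω - (n : ℝ) • y‖ ≤ A * (n * δ y) := by gcongr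
            have h3 : n * (A * δ y) ≤ n * η := by gcongr; exact hAδ y
            nlinarith
          · refine mul_nonneg (Real.exp_pos _).le ?_
            split_ifs
            exacts [hp _ _, le_rfl]
      _ = ∑ y ∈ s, Real.exp (n * (t ⬝ᵥ y + η)) * nearMass p X n ((n : ℝ) • y) (n * δ y) := by
          rw [Finset.sum_comm]
          simp only [nearMass, Finset.mul_sum]
      _ ≤ ∑ y ∈ s, Real.exp (n * (β + 2 * η)) := by
          refine Finset.sum_le_sum fun y hy => ?_
          refine (mul_le_mul_of_nonneg_left (hn y hy) (Real.exp_pos _).le).trans ?_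
          rw [← Real.exp_add]
          apply Real.exp_le_exp.mpr
          nlinarith
      _ = _ := by rw [Finset.sum_const, nsmul_eq_mul]
  have hbig : Filter.Tendsto (fun n : ℕ => Real.exp (n * η)) Filter.atTop Filter.atTop :=
    Real.tendsto_exp_atTop.comp (tendsto_natCast_atTop_atTop.atTop_mul_const hη0)
  obtain ⟨n, h1, h2, h3⟩ := ((hL η hη0).and (hup.and
    (hbig.eventually_gt_atTop (s.card : ℝ)))).exists
  have h4 := h1.trans h2
  have h5 : Real.exp (n * (L - η)) = Real.exp (n * η) * Real.exp (n * (β + 2 * η)) := by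
    rw [← Real.exp_add]
    congr 1
    rw [hη]
    ring
  rw [h5] at h4
  exact absurd (le_of_mul_le_mul_right h4 (Real.exp_pos _)) (not_le.mpr h3)

theorem mem_rateSet_of_forall_le {c K : ℝ} {N : ℕ} (hp : ∀ n ω, 0 ≤ p n ω)
    (hX : ∀ n ω, ‖X n ω‖ ≤ n)
    (h : IsSupermultiplicative (nearMass p X) c N K) {Λ : (ι → ℝ) → ℝ}
    (hL : ∀ t, ∀ ε > 0, ∀ᶠ n : ℕ in Filter.atTop, Real.exp (n * (Λ t - ε)) ≤ laplace p X n t)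
    {x : ι → ℝ} {a : ℝ} (hx : ∀ t, t ⬝ᵥ x - Λ t ≤ a) : (x, a) ∈ rateSet (nearMass p X) := by
  by_contra hmem
  obtain ⟨f, u, hfu, hu⟩ := geometric_hahn_banach_closed_point h.convex_rateSet
    h.isClosed_rateSet hmem
  have hs0 : ∀ z ∈ rateSet (nearMass p X), 0 ≤ z.2 := fun z hz =>
    h.rate_nonneg fun δ hδ ε hε => (hz δ hδ ε hε).frequently
  set b : ℝ := f (0, 1) with hb
  set t : ι → ℝ := fun i => f (Pi.single i 1, 0) with ht
  have hf : ∀ z : (ι → ℝ) × ℝ, f z = t ⬝ᵥ z.1 + b * z.2 := by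
    rintro ⟨y, s⟩
    have e : ((y, s) : (ι → ℝ) × ℝ)
        = ∑ i, y i • ((Pi.single i 1, 0) : (ι → ℝ) × ℝ) + s • ((0, 1) : (ι → ℝ) × ℝ) := by
      refine Prod.ext ?_ ?_
      · simp only [Prod.fst_add, Prod.fst_sum, Prod.smul_fst, smul_zero, add_zero]
        exact pi_eq_sum_univ' y
      · simp [Prod.snd_sum]
    rw [e, map_add, map_sum, map_smul]
    simp only [map_smul, smul_eq_mul, dotProduct, ht, ← e]
    rw [← hb, mul_comm s b]
    congr 1
    exact Finset.sum_congr rfl fun i _ => mul_comm _ _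
  have hne : (rateSet (nearMass p X)).Nonempty := by
    by_contra hemp
    rw [Set.not_nonempty_iff_eq_empty] at hemp
    have := le_of_forall_mem_rateSet hp hX h (hL 0) (β := Λ 0 - 1) (by simp [hemp])
    linarith
  have hup : ∀ z ∈ rateSet (nearMass p X), ∀ r ≥ 0, (z.1, z.2 + r) ∈ rateSet (nearMass p X) := by
    intro z hz r hr δ hδ ε hε
    filter_upwards [hz δ hδ ε hε] with n hn
    refine le_trans (Real.exp_le_exp.mpr ?_) hn
    have : (0 : ℝ) ≤ n := by positivity
    nlinarith [mul_nonneg this hr]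
  have hb0 : b ≤ 0 := by
    by_contra! hpos
    obtain ⟨z, hz⟩ := hne
    have h1 := hfu _ (hup z hz (|u - f z| / b) (by positivity))
    rw [hf] at h1
    rw [hf z] at h1
    have h2 : b * (|u - (t ⬝ᵥ z.1 + b * z.2)| / b) = |u - (t ⬝ᵥ z.1 + b * z.2)| := by
      field_simp
    have h3 := le_abs_self (u - (t ⬝ᵥ z.1 + b * z.2))
    dsimp only at h1
    rw [mul_add, h2] at h1
    linarith
  rw [hf] at hu
  dsimp only at hu
  set gap := t ⬝ᵥ x + b * a - u with hgap
  have hgap0 : 0 < gap := by rw [hgap]; linarith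
  /- A multiple of `f` plus a little of the vertical functional has negative vertical part. -/
  obtain ⟨l, hl0, hl⟩ : ∃ l : ℝ, 0 < l ∧ l * gap > a := ⟨(|a| + 1) / gap, by positivity, by
    rw [div_mul_cancel₀ _ hgap0.ne']; linarith [le_abs_self a]⟩
  have hden : 0 < 1 - l * b := by nlinarith
  set k := (1 - l * b)⁻¹ with hk
  have hk0 : 0 < k := inv_pos.mpr hden
  have hkd : k * (1 - l * b) = 1 := inv_mul_cancel₀ hden.ne'
  have hΛ : Λ ((k * l) • t) ≤ k * (l * u) := by
    refine le_of_forall_mem_rateSet hp hX h (hL _) fun z hz => ?_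
    have h1 := hfu z hz
    rw [hf] at h1
    have h2 := hs0 z hz
    rw [smul_dotProduct, smul_eq_mul]
    have h3 : l * (t ⬝ᵥ z.1) - (1 - l * b) * z.2 ≤ l * u := by nlinarith
    have h4 := mul_le_mul_of_nonneg_left h3 hk0.le
    have h5 : k * ((1 - l * b) * z.2) = z.2 := by rw [← mul_assoc, hkd, one_mul]
    nlinarith
  have h1 := hx ((k * l) • t)
  rw [smul_dotProduct, smul_eq_mul] at h1
  have h2 : l * (t ⬝ᵥ x) - (1 - l * b) * a > l * u := by
    rw [hgap] at hl
    nlinarith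
  have h3 := mul_lt_mul_of_pos_left h2 hk0
  have h5 : k * ((1 - l * b) * a) = a := by rw [← mul_assoc, hkd, one_mul]
  nlinarith

theorem eventually_mass_le {C : ℝ} (hp : ∀ n ω, 0 ≤ p n ω) {Λ : (ι → ℝ) → ℝ}
    (hL : ∀ t, ∀ ε > 0, ∀ᶠ n : ℕ in Filter.atTop, laplace p X n t ≤ Real.exp (n * (Λ t + ε)))
    {Z : ∀ n, Ω n → ι → ℝ} (hZ : ∀ n ω, ‖Z n ω‖ ≤ 1)
    (hZX : ∀ᶠ n : ℕ in Filter.atTop, ∀ ω, ‖(n : ℝ) • Z n ω - X n ω‖ ≤ C)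
    {B : Set (ι → ℝ)} (hB : IsClosed B) {b b' : ℝ} (hb : b' < b)
    (hx : ∀ x ∈ B, ∃ t, b < t ⬝ᵥ x - Λ t) :
    ∀ᶠ n : ℕ in Filter.atTop,
      (∑ ω, if Z n ω ∈ B then p n ω else 0) ≤ Real.exp (-(n * b')) := by
  have key : ∀ x ∈ B, ∃ δ > 0, ∀ᶠ n : ℕ in Filter.atTop,
      (∑ ω, if ‖Z n ω - x‖ < δ then p n ω else 0) ≤ Real.exp (-(n * b)) := by
    intro x hxB
    obtain ⟨t, ht⟩ := hx x hxB
    set η := (t ⬝ᵥ x - Λ t - b) / 3 with hη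
    have hη0 : 0 < η := by rw [hη]; linarith
    set A : ℝ := ∑ i, |t i| with hA
    have hA0 : 0 ≤ A := Finset.sum_nonneg fun i _ => abs_nonneg _
    refine ⟨η / (A + 1), by positivity, ?_⟩
    filter_upwards [hL t η hη0, hZX,
      tendsto_natCast_atTop_atTop.eventually_ge_atTop (A * C / η)] with n hn hnZ hnC
    rw [div_le_iff₀ hη0] at hnC
    have hn0 : (0 : ℝ) ≤ n := by positivity
    calc (∑ ω, if ‖Z n ω - x‖ < η / (A + 1) then p n ω else 0)
        ≤ ∑ ω, Real.exp (-(n * (t ⬝ᵥ x - 2 * η))) * (p n ω * Real.exp (t ⬝ᵥ X n ω)) := by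
          refine Finset.sum_le_sum fun ω _ => ?_
          split_ifs with hω
          · rw [mul_left_comm, ← Real.exp_add]
            refine le_mul_of_one_le_right (hp _ _) (Real.one_le_exp ?_)
            have h1 := (neg_abs_le _).trans' (neg_le_neg (abs_dotProduct_le t (Z n ω - x)))
            have h2 := (le_abs_self _).trans (abs_dotProduct_le t ((n : ℝ) • Z n ω - X n ω))
            rw [dotProduct_sub] at h1
            rw [dotProduct_sub, dotProduct_smul, smul_eq_mul] at h2
            have h3 : A * ‖Z n ω - x‖ ≤ η := by
              calc A * ‖Z n ω - x‖ ≤ A * (η / (A + 1)) := by gcongr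
                _ = η * (A / (A + 1)) := by ring
                _ ≤ η * 1 := by gcongr; rw [div_le_one (by positivity)]; linarith
                _ = η := mul_one _
            have h4 : A * ‖(n : ℝ) • Z n ω - X n ω‖ ≤ A * C := by gcongr; exact hnZ ω
            have h5 : t ⬝ᵥ x - η ≤ t ⬝ᵥ Z n ω := by linarith
            have h6 := mul_le_mul_of_nonneg_left h5 hn0
            nlinarith
          · exact mul_nonneg (Real.exp_pos _).le (mul_nonneg (hp _ _) (Real.exp_pos _).le)
      _ = Real.exp (-(n * (t ⬝ᵥ x - 2 * η))) * laplace p X n t := by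
          rw [laplace, Finset.mul_sum]
      _ ≤ Real.exp (-(n * (t ⬝ᵥ x - 2 * η))) * Real.exp (n * (Λ t + η)) := by gcongr
      _ = Real.exp (-(n * b)) := by
          rw [← Real.exp_add]; congr 1; rw [hη]; ring
  choose! δ hδ hev using key
  obtain ⟨s, hsB, hs⟩ := ((isCompact_closedBall (0 : ι → ℝ) 1).inter_left hB).elim_nhds_subcover
    (fun y => Metric.ball y (δ y)) (fun y hy => Metric.ball_mem_nhds y (hδ y hy.1))
  have hall := (Filter.eventually_all_finset s).mpr fun y hy => hev y (hsB y hy).1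
  have hbig : Filter.Tendsto (fun n : ℕ => Real.exp (n * (b - b'))) Filter.atTop Filter.atTop :=
    Real.tendsto_exp_atTop.comp
      (tendsto_natCast_atTop_atTop.atTop_mul_const (sub_pos.mpr hb))
  filter_upwards [hall, hbig.eventually_ge_atTop (s.card : ℝ)] with n hn hcard
  calc (∑ ω, if Z n ω ∈ B then p n ω else 0)
      ≤ ∑ ω, ∑ y ∈ s, if ‖Z n ω - y‖ < δ y then p n ω else 0 := by
        refine Finset.sum_le_sum fun ω _ => ?_
        have hnn : ∀ y ∈ s, 0 ≤ if ‖Z n ω - y‖ < δ y then p n ω else 0 := fun y _ => by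
          split_ifs
          exacts [hp _ _, le_rfl]
        by_cases hω : Z n ω ∈ B
        · obtain ⟨y, hys, hy⟩ := Set.mem_iUnion₂.mp
            (hs ⟨hω, mem_closedBall_zero_iff.mpr (hZ n ω)⟩)
          rw [Metric.mem_ball, dist_eq_norm] at hy
          refine le_trans ?_ (Finset.single_le_sum hnn hys)
          rw [if_pos hω, if_pos hy]
        · rw [if_neg hω]
          exact Finset.sum_nonneg hnn
    _ = ∑ y ∈ s, ∑ ω, if ‖Z n ω - y‖ < δ y then p n ω else 0 := Finset.sum_comm
    _ ≤ ∑ y ∈ s, Real.exp (-(n * b)) := Finset.sum_le_sum hn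
    _ = s.card * Real.exp (-(n * b)) := by rw [Finset.sum_const, nsmul_eq_mul]
    _ ≤ Real.exp (n * (b - b')) * Real.exp (-(n * b)) := by gcongr
    _ = Real.exp (-(n * b')) := by rw [← Real.exp_add]; congr 1; ring

end LargeDeviations

section Words

/-- The squared Euclidean norm of a complex vector. -/
noncomputable def normSqVec {d : ℕ} (v : Fin d → ℂ) : ℝ := ∑ x, ‖v x‖ ^ 2

/-- The squared Hilbert-Schmidt norm of a complex matrix. -/
noncomputable def normSqMat {d : ℕ} (A : Matrix (Fin d) (Fin d) ℂ) : ℝ := ∑ x, normSqVec (A x)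

/-- The product of Kraus operators along a word given as a list, last letter leftmost. -/
noncomputable def listProd {d k : ℕ} (V : Fin k → Matrix (Fin d) (Fin d) ℂ)
    (l : List (Fin k)) : Matrix (Fin d) (Fin d) ℂ :=
  (l.reverse.map V).prod

/-- The number of occurrences of each word of length `m' + 1` as a factor of a list. -/
noncomputable def windowCount {k : ℕ} (m' : ℕ) : List (Fin k) → (Fin (m' + 1) → Fin k) → ℝ
  | [] => 0
  | a :: l => fun w => (if List.ofFn w <+: a :: l then 1 else 0) + windowCount m' l w

variable {d k : ℕ}

theorem normSqVec_nonneg (v : Fin d → ℂ) : 0 ≤ normSqVec v :=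
  Finset.sum_nonneg fun _ _ => by positivity

theorem normSqMat_nonneg (A : Matrix (Fin d) (Fin d) ℂ) : 0 ≤ normSqMat A :=
  Finset.sum_nonneg fun _ _ => normSqVec_nonneg _

theorem star_dotProduct_self (v : Fin d → ℂ) : star v ⬝ᵥ v = (normSqVec v : ℂ) := by
  simp [dotProduct, normSqVec, Complex.conj_mul']

theorem normSqVec_mulVec_le (A : Matrix (Fin d) (Fin d) ℂ) (v : Fin d → ℂ) :
    normSqVec (A *ᵥ v) ≤ normSqMat A * normSqVec v := by
  rw [normSqMat, Finset.sum_mul, normSqVec]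
  refine Finset.sum_le_sum fun x _ => ?_
  calc ‖(A *ᵥ v) x‖ ^ 2 ≤ (∑ y, ‖A x y‖ * ‖v y‖) ^ 2 := by
        gcongr
        rw [mulVec, dotProduct]
        exact (norm_sum_le _ _).trans (Finset.sum_le_sum fun y _ => (norm_mul _ _).le)
    _ ≤ _ := Finset.sum_mul_sq_le_sq_mul_sq _ _ _

theorem normSqVec_le (v : Fin d → ℂ) : normSqVec v ≤ d * ‖v‖ ^ 2 := by
  refine (Finset.sum_le_card_nsmul _ _ (‖v‖ ^ 2) fun x _ => ?_).trans (by simp)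
  gcongr
  exact norm_le_pi_norm v x

theorem normSqMat_of_le (A : Fin d → Fin d → ℂ) :
    normSqMat (Matrix.of A) ≤ d * (d * ‖A‖ ^ 2) := by
  refine (Finset.sum_le_card_nsmul _ _ (d * ‖A‖ ^ 2) fun x _ => ?_).trans (by simp)
  refine (normSqVec_le _).trans ?_
  gcongr
  exact norm_le_pi_norm A x

theorem listProd_append (V : Fin k → Matrix (Fin d) (Fin d) ℂ) (l l' : List (Fin k)) :
    listProd V (l ++ l') = listProd V l' * listProd V l := by
  simp [listProd]

theorem listProd_cons (V : Fin k → Matrix (Fin d) (Fin d) ℂ) (a : Fin k) (l : List (Fin k)) :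
    listProd V (a :: l) = listProd V l * V a := by
  simp [listProd]

theorem outProb_eq {n : ℕ} (V : Fin k → Matrix (Fin d) (Fin d) ℂ) (ψ : Fin d → ℂ)
    (i : Fin n → Fin k) : outProb V ψ i = normSqVec (listProd V (List.ofFn i) *ᵥ ψ) := rfl

theorem sum_fin_succ_pi {α M : Type*} [Fintype α] [AddCommMonoid M] (n : ℕ)
    (f : (Fin (n + 1) → α) → M) :
    ∑ i, f i = ∑ a, ∑ w : Fin n → α, f (Fin.cons a w) := by
  rw [← Fintype.sum_prod_type']
  exact (Fintype.sum_equiv (Fin.consEquiv fun _ => α) _ _ fun _ => rfl).symm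

theorem sum_fin_add_pi {α M : Type*} [Fintype α] [AddCommMonoid M] (a b : ℕ)
    (f : (Fin (a + b) → α) → M) :
    ∑ i, f i = ∑ u : Fin a → α, ∑ v : Fin b → α, f (Fin.append u v) := by
  rw [← Fintype.sum_prod_type']
  exact (Fintype.sum_equiv (Fin.appendEquiv a b) _ _ fun _ => rfl).symm

theorem Tmap_iterate (V : Fin k → Matrix (Fin d) (Fin d) ℂ) (n : ℕ)
    (A : Matrix (Fin d) (Fin d) ℂ) :
    (Tmap V)^[n] A
      = ∑ g : Fin n → Fin k, (listProd V (List.ofFn g))ᴴ * A * listProd V (List.ofFn g) := by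
  induction n with
  | zero => simp [listProd]
  | succ n ih =>
    rw [Function.iterate_succ_apply', ih, sum_fin_succ_pi, Tmap]
    refine Finset.sum_congr rfl fun a _ => ?_
    rw [Finset.mul_sum, Finset.sum_mul]
    refine Finset.sum_congr rfl fun w _ => ?_
    rw [List.ofFn_cons, listProd_cons, conjTranspose_mul]
    simp only [Matrix.mul_assoc]

theorem sum_normSqVec_mulVec (V : Fin k → Matrix (Fin d) (Fin d) ℂ) (n : ℕ)
    (A : Matrix (Fin d) (Fin d) ℂ) (u : Fin d → ℂ) :
    ((∑ g : Fin n → Fin k, normSqVec ((A * listProd V (List.ofFn g)) *ᵥ u) : ℝ) : ℂ)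
      = star u ⬝ᵥ ((Tmap V)^[n] (Aᴴ * A) *ᵥ u) := by
  rw [Tmap_iterate, Complex.ofReal_sum, sum_mulVec, dotProduct_sum]
  refine Finset.sum_congr rfl fun g _ => ?_
  rw [← star_dotProduct_self, star_mulVec, ← dotProduct_mulVec, mulVec_mulVec, conjTranspose_mul]
  simp only [Matrix.mul_assoc]

theorem sum_normSqVec_listProd {V : Fin k → Matrix (Fin d) (Fin d) ℂ}
    (hnorm : ∑ i : Fin k, (V i)ᴴ * V i = 1) (n : ℕ) (u : Fin d → ℂ) :
    ∑ g : Fin n → Fin k, normSqVec (listProd V (List.ofFn g) *ᵥ u) = normSqVec u := by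
  have h := sum_normSqVec_mulVec V n 1 u
  have h1 : (Tmap V)^[n] 1 = 1 := Function.iterate_fixed (by simp [Tmap, hnorm]) n
  rw [conjTranspose_one, Matrix.one_mul, h1, one_mulVec, star_dotProduct_self] at h
  simpa using Complex.ofReal_injective h

theorem sum_outProb {V : Fin k → Matrix (Fin d) (Fin d) ℂ}
    (hnorm : ∑ i : Fin k, (V i)ᴴ * V i = 1) {ψ : Fin d → ℂ} (hψ : normSqVec ψ = 1) (n : ℕ) :
    ∑ i : Fin n → Fin k, outProb V ψ i = 1 := by
  simp only [outProb_eq]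
  rw [sum_normSqVec_listProd hnorm, hψ]

theorem outProb_nonneg {n : ℕ} (V : Fin k → Matrix (Fin d) (Fin d) ℂ) (ψ : Fin d → ℂ)
    (i : Fin n → Fin k) : 0 ≤ outProb V ψ i := normSqVec_nonneg _

theorem exists_forall_mul_norm_sq_le {V : Fin k → Matrix (Fin d) (Fin d) ℂ} {N : ℕ} [NeZero d]
    (hprim : ∀ A : Matrix (Fin d) (Fin d) ℂ,
      A.PosSemidef → A ≠ 0 → ((Tmap V)^[N] A).PosDef) :
    ∃ c : ℝ, 0 < c ∧ ∀ (A : Fin d → Fin d → ℂ) (u : Fin d → ℂ), c * ‖A‖ ^ 2 * ‖u‖ ^ 2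
        ≤ ∑ g : Fin N → Fin k, normSqVec ((Matrix.of A * listProd V (List.ofFn g)) *ᵥ u) := by
  set h : (Fin d → Fin d → ℂ) × (Fin d → ℂ) → ℝ := fun z =>
    ∑ g : Fin N → Fin k, normSqVec (((Matrix.of z.1) * listProd V (List.ofFn g)) *ᵥ z.2) with hh
  have hcont : Continuous h := by
    simp only [hh, normSqVec]
    refine continuous_finsetSum _ fun g _ => continuous_finsetSum _ fun x _ => ?_
    refine Continuous.pow (Continuous.norm ?_) 2
    simp only [mulVec, dotProduct, Matrix.mul_apply, Matrix.of_apply]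
    fun_prop
  have hpos : ∀ z, z.1 ≠ 0 → z.2 ≠ 0 → 0 < h z := by
    intro z h1 h2
    have hA : (Matrix.of z.1)ᴴ * Matrix.of z.1 ≠ 0 := by
      rw [Ne, Matrix.conjTranspose_mul_self_eq_zero]
      exact fun h0 => h1 h0
    have hP := (hprim _ (Matrix.posSemidef_conjTranspose_mul_self _) hA).dotProduct_mulVec_pos h2
    rw [← sum_normSqVec_mulVec] at hP
    exact_mod_cast hP
  have hcpt : IsCompact (Metric.sphere (0 : Fin d → Fin d → ℂ) 1 ×ˢ
      Metric.sphere (0 : Fin d → ℂ) 1) := (isCompact_sphere _ _).prod (isCompact_sphere _ _)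
  have hne : (Metric.sphere (0 : Fin d → Fin d → ℂ) 1 ×ˢ
      Metric.sphere (0 : Fin d → ℂ) 1).Nonempty :=
    (NormedSpace.sphere_nonempty.mpr zero_le_one).prod
      (NormedSpace.sphere_nonempty.mpr zero_le_one)
  obtain ⟨z₀, hz₀, hmin⟩ := hcpt.exists_isMinOn hne hcont.continuousOn
  have hz1 : z₀.1 ≠ 0 := Metric.ne_of_mem_sphere hz₀.1 one_ne_zero
  have hz2 : z₀.2 ≠ 0 := Metric.ne_of_mem_sphere hz₀.2 one_ne_zero
  have hc₀ := hpos z₀ hz1 hz2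
  refine ⟨h z₀, hc₀, ?_⟩
  intro A u
  by_cases hA : A = 0
  · subst hA; simp [hh, normSqVec]
  by_cases hu : u = 0
  · subst hu; simp [hh, normSqVec]
  have hA' := norm_pos_iff.mpr hA
  have hu' := norm_pos_iff.mpr hu
  have e1 : ((‖A‖⁻¹ : ℝ) • A, (‖u‖⁻¹ : ℝ) • u) ∈ Metric.sphere (0 : Fin d → Fin d → ℂ) 1 ×ˢ
      Metric.sphere (0 : Fin d → ℂ) 1 := by
    constructor
    · rw [mem_sphere_zero_iff_norm, norm_smul, norm_inv, norm_norm, inv_mul_cancel₀ hA'.ne']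
    · rw [mem_sphere_zero_iff_norm, norm_smul, norm_inv, norm_norm, inv_mul_cancel₀ hu'.ne']
  have e2 : h ((‖A‖⁻¹ : ℝ) • A, (‖u‖⁻¹ : ℝ) • u) = (‖A‖⁻¹) ^ 2 * (‖u‖⁻¹) ^ 2 * h (A, u) := by
    simp only [hh, normSqVec, Finset.mul_sum]
    refine Finset.sum_congr rfl fun g _ => Finset.sum_congr rfl fun x _ => ?_
    have : Matrix.of ((‖A‖⁻¹ : ℝ) • A) = (‖A‖⁻¹ : ℝ) • Matrix.of A := rfl
    rw [this, Matrix.smul_mul, Matrix.mulVec_smul, Matrix.smul_mulVec, Pi.smul_apply,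
      Pi.smul_apply, norm_smul, norm_smul, mul_pow, mul_pow, norm_inv, norm_inv, norm_norm,
      norm_norm]
    ring
  have e3 := hmin e1
  simp only [Set.mem_ofPred_eq] at e3
  rw [e2] at e3
  calc h z₀ * ‖A‖ ^ 2 * ‖u‖ ^ 2
      ≤ ((‖A‖⁻¹) ^ 2 * (‖u‖⁻¹) ^ 2 * h (A, u)) * ‖A‖ ^ 2 * ‖u‖ ^ 2 := by gcongr
    _ = h (A, u) := by
      generalize h (A, u) = e
      field_simp

/-- Primitivity provides a uniform lower bound for connecting two words by a word of length `N`. -/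
theorem exists_connecting_constant {V : Fin k → Matrix (Fin d) (Fin d) ℂ} {N : ℕ}
    (hprim : ∀ A : Matrix (Fin d) (Fin d) ℂ,
      A.PosSemidef → A ≠ 0 → ((Tmap V)^[N] A).PosDef) :
    ∃ c : ℝ, 0 < c ∧ c ≤ 1 ∧ ∀ (A : Matrix (Fin d) (Fin d) ℂ) (u : Fin d → ℂ),
      c * normSqMat A * normSqVec u
        ≤ ∑ g : Fin N → Fin k, normSqVec ((A * listProd V (List.ofFn g)) *ᵥ u) := by
  rcases Nat.eq_zero_or_pos d with rfl | hd
  · exact ⟨1, one_pos, le_rfl, fun A u => by simp [normSqVec]⟩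
  have : NeZero d := ⟨hd.ne'⟩
  have hdr : (0 : ℝ) < d := by exact_mod_cast hd
  obtain ⟨c, hc, hbound⟩ := exists_forall_mul_norm_sq_le hprim
  refine ⟨min 1 (c / (d * d * d)), by positivity, min_le_left _ _, fun A u => ?_⟩
  obtain ⟨A, rfl⟩ := Matrix.of.surjective A
  refine le_trans ?_ (hbound A u)
  have h1 := normSqMat_of_le A
  have h2 := normSqVec_le u
  have h3 := normSqVec_nonneg u
  have h4 := normSqMat_nonneg (Matrix.of A)
  calc min 1 (c / (d * d * d)) * normSqMat (Matrix.of A) * normSqVec u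
      ≤ (c / (d * d * d)) * (d * (d * ‖A‖ ^ 2)) * (d * ‖u‖ ^ 2) :=
        mul_le_mul (mul_le_mul (min_le_right _ _) h1 h4 (by positivity)) h2 h3 (by positivity)
    _ = c * ‖A‖ ^ 2 * ‖u‖ ^ 2 := by
        field_simp

theorem windowCount_nonneg (m' : ℕ) (l : List (Fin k)) (w : Fin (m' + 1) → Fin k) :
    0 ≤ windowCount m' l w := by
  induction l with
  | nil => simp [windowCount]
  | cons a l ih =>
    simp only [windowCount]
    split_ifs <;> linarith

theorem windowCount_le_length (m' : ℕ) (l : List (Fin k)) (w : Fin (m' + 1) → Fin k) :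
    windowCount m' l w ≤ l.length := by
  induction l with
  | nil => simp [windowCount]
  | cons a l ih =>
    simp only [windowCount, List.length_cons]
    push_cast
    split_ifs <;> linarith

theorem windowCount_append_bounds (m' : ℕ) (l l' : List (Fin k)) (w : Fin (m' + 1) → Fin k) :
    windowCount m' l w + windowCount m' l' w ≤ windowCount m' (l ++ l') w ∧
      windowCount m' (l ++ l') w
        ≤ windowCount m' l w + windowCount m' l' w + (min l.length m' : ℕ) := by
  induction l with
  | nil => simp [windowCount]
  | cons a l ih =>
    obtain ⟨h1, h2⟩ := ih
    simp only [List.cons_append, windowCount]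
    by_cases hl : m' + 1 ≤ (a :: l).length
    · have e : (List.ofFn w <+: a :: (l ++ l')) ↔ (List.ofFn w <+: a :: l) := by
        rw [← List.cons_append]
        refine ⟨fun h => ?_, fun h => h.trans (List.prefix_append _ _)⟩
        exact List.prefix_of_prefix_length_le h (List.prefix_append _ _) (by simpa using hl)
      have e2 : ((min l.length m' : ℕ) : ℝ) ≤ (min (a :: l).length m' : ℕ) := by
        gcongr; simp
      rw [if_congr e rfl rfl]
      constructor <;> linarith
    · rw [List.length_cons] at hl
      have e1 : ¬ (List.ofFn w <+: a :: l) := fun h => by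
        have := h.length_le
        rw [List.length_ofFn, List.length_cons] at this
        omega
      have e2 : min l.length m' = l.length := by omega
      have e3 : min (a :: l).length m' = l.length + 1 := by rw [List.length_cons]; omega
      rw [e2] at h2
      rw [if_neg e1, e3]
      push_cast
      split_ifs <;> constructor <;> linarith

theorem norm_windowCount_le (m' : ℕ) (l : List (Fin k)) : ‖windowCount m' l‖ ≤ l.length := by
  rw [pi_norm_le_iff_of_nonneg (by positivity)]
  intro w
  rw [Real.norm_of_nonneg (windowCount_nonneg _ _ _)]
  exact windowCount_le_length _ _ _

theorem norm_windowCount_append_sub_le (m' : ℕ) (l l' : List (Fin k)) :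
    ‖windowCount m' (l ++ l') - (windowCount m' l + windowCount m' l')‖ ≤ m' := by
  rw [pi_norm_le_iff_of_nonneg (by positivity)]
  intro w
  obtain ⟨h1, h2⟩ := windowCount_append_bounds m' l l' w
  have h3 : ((min l.length m' : ℕ) : ℝ) ≤ m' := by exact_mod_cast min_le_right _ _
  rw [Pi.sub_apply, Pi.add_apply, Real.norm_eq_abs, abs_le]
  constructor <;> linarith

theorem norm_windowCount_append_append_sub_le (m' : ℕ) (l g l' : List (Fin k)) :
    ‖windowCount m' (l ++ g ++ l') - (windowCount m' l + windowCount m' l')‖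
      ≤ 2 * m' + g.length := by
  have h1 := norm_windowCount_append_sub_le m' l g
  have h2 := norm_windowCount_append_sub_le m' (l ++ g) l'
  have h3 := norm_windowCount_le m' g
  have e : windowCount m' (l ++ g ++ l') - (windowCount m' l + windowCount m' l')
      = (windowCount m' (l ++ g ++ l') - (windowCount m' (l ++ g) + windowCount m' l'))
        + (windowCount m' (l ++ g) - (windowCount m' l + windowCount m' g))
        + windowCount m' g := by abel
  rw [e]
  refine (norm_add₃_le).trans ?_
  linarith

theorem isSupermultiplicative_nearMass {V : Fin k → Matrix (Fin d) (Fin d) ℂ} (m' : ℕ)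
    (hnorm : ∑ i : Fin k, (V i)ᴴ * V i = 1) {ψ : Fin d → ℂ} (hψ : normSqVec ψ = 1)
    {N : ℕ} {c : ℝ} (hc0 : 0 < c) (hc1 : c ≤ 1)
    (hc : ∀ (A : Matrix (Fin d) (Fin d) ℂ) (u : Fin d → ℂ),
      c * normSqMat A * normSqVec u
        ≤ ∑ g : Fin N → Fin k, normSqVec ((A * listProd V (List.ofFn g)) *ᵥ u)) :
    IsSupermultiplicative
      (nearMass (Ω := fun n => Fin n → Fin k) (fun _ i => outProb V ψ i)
        (fun _ i => windowCount m' (List.ofFn i))) c N (2 * m' + N) where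
  c_pos := hc0
  c_le_one := hc1
  K_nonneg := by positivity
  nonneg n x r := Finset.sum_nonneg fun i _ => by
    split_ifs
    exacts [outProb_nonneg _ _ _, le_rfl]
  le_one n x r := by
    rw [← sum_outProb hnorm hψ n]
    refine Finset.sum_le_sum fun i _ => ?_
    split_ifs
    exacts [le_rfl, outProb_nonneg _ _ _]
  one_le_zero n := by
    rw [← sum_outProb hnorm hψ n]
    refine Finset.sum_le_sum fun i _ => ?_
    rw [if_pos]
    simpa using norm_windowCount_le m' (List.ofFn i)
  le_of_near n x y r s h := by
    refine Finset.sum_le_sum fun i _ => ?_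
    split_ifs with h1 h2
    · exact le_rfl
    · refine absurd ?_ h2
      have : windowCount m' (List.ofFn i) - y = (windowCount m' (List.ofFn i) - x) + (x - y) := by
        abel
      rw [this]
      exact (norm_add_le _ _).trans (by linarith)
    · exact outProb_nonneg _ _ _
    · exact le_rfl
  mul_le a b x y r s := by
    simp only [nearMass]
    rw [sum_fin_add_pi, sum_fin_add_pi, mul_assoc, Finset.sum_mul, Finset.mul_sum]
    refine Finset.sum_le_sum fun u _ => ?_
    rw [Finset.sum_comm, Finset.mul_sum, Finset.mul_sum]
    refine Finset.sum_le_sum fun v _ => ?_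
    have hnn : 0 ≤ ∑ g : Fin N → Fin k,
        if ‖windowCount m' (List.ofFn (Fin.append (Fin.append u g) v)) - (x + y)‖
            ≤ r + s + (2 * m' + N)
        then outProb V ψ (Fin.append (Fin.append u g) v) else 0 :=
      Finset.sum_nonneg fun i _ => by
        split_ifs
        exacts [outProb_nonneg _ _ _, le_rfl]
    split_ifs with hu hv
    · have hle := hc (listProd V (List.ofFn v)) (listProd V (List.ofFn u) *ᵥ ψ)
      calc c * (outProb V ψ u * outProb V ψ v)
          = c * outProb V ψ u * outProb V ψ v := by ring
        _ ≤ c * outProb V ψ u * normSqMat (listProd V (List.ofFn v)) := by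
            have h1 := normSqVec_mulVec_le (listProd V (List.ofFn v)) ψ
            rw [hψ, mul_one] at h1
            exact mul_le_mul_of_nonneg_left h1 (mul_nonneg hc0.le (outProb_nonneg _ _ _))
        _ = c * normSqMat (listProd V (List.ofFn v)) * outProb V ψ u := by ring
        _ ≤ _ := hle
        _ = _ := by
          refine Finset.sum_congr rfl fun g _ => ?_
          have hlist : List.ofFn (Fin.append (Fin.append u g) v)
              = List.ofFn u ++ List.ofFn g ++ List.ofFn v := by
            rw [List.ofFn_fin_append, List.ofFn_fin_append]
          rw [if_pos, outProb_eq, hlist, listProd_append, listProd_append, mulVec_mulVec]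
          · simp only [Matrix.mul_assoc]
          · rw [hlist]
            have h1 := norm_windowCount_append_append_sub_le m' (List.ofFn u) (List.ofFn g)
              (List.ofFn v)
            rw [List.length_ofFn] at h1
            have e : windowCount m' (List.ofFn u ++ List.ofFn g ++ List.ofFn v) - (x + y)
              = (windowCount m' (List.ofFn u ++ List.ofFn g ++ List.ofFn v)
                - (windowCount m' (List.ofFn u) + windowCount m' (List.ofFn v)))
                + (windowCount m' (List.ofFn u) - x) + (windowCount m' (List.ofFn v) - y) := by
              abel
            rw [e]
            refine norm_add₃_le.trans ?_
            linarith
    all_goals simpa using hnn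

end Words

section FiniteDimensionalSpectrum

theorem exists_norm_apply_le_mul_norm {A : Type*} [NormedRing A] [NormedAlgebra ℂ A]
    [FiniteDimensional ℂ A] (l : A →ₗ[ℂ] ℂ) : ∃ K : ℝ, 0 ≤ K ∧ ∀ a, ‖l a‖ ≤ K * ‖a‖ :=
  ⟨‖LinearMap.toContinuousLinearMap l‖, norm_nonneg _,
    fun a => (LinearMap.toContinuousLinearMap l).le_opNorm a⟩

theorem spectralRadius_ne_top {A : Type*} [NormedRing A] [NormedAlgebra ℂ A] [CompleteSpace A]
    (a : A) : spectralRadius ℂ a ≠ ⊤ := by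
  have h := spectrum.spectralRadius_le_pow_nnnorm_pow_one_div ℂ a 0
  exact ne_top_of_le_ne_top (by simp [ENNReal.mul_eq_top]) h

variable {E : Type*} [AddCommGroup E] [Module ℂ E] [FiniteDimensional ℂ E]

attribute [local instance] Matrix.linftyOpNormedRing Matrix.linftyOpNormedAlgebra

theorem exists_norm_apply_pow_le (S : Module.End ℂ E) (φ : E →ₗ[ℂ] ℂ) (x : E) {ρ : ℝ}
    (hρ : (spectralRadius ℂ S).toReal < ρ) : ∃ C : ℝ, ∀ q : ℕ, ‖φ ((S ^ q) x)‖ ≤ C * ρ ^ q := by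
  set b := Module.finBasis ℂ E
  set e := LinearMap.toMatrixAlgEquiv b
  have : CompleteSpace (Matrix (Fin (Module.finrank ℂ E)) (Fin (Module.finrank ℂ E)) ℂ) :=
    FiniteDimensional.complete ℂ _
  have hr : spectralRadius ℂ (e S) = spectralRadius ℂ S := by
    simp only [spectralRadius, AlgEquiv.spectrum_eq]
  have hρ0 : 0 < ρ := ENNReal.toReal_nonneg.trans_lt hρ
  set l : Matrix (Fin (Module.finrank ℂ E)) (Fin (Module.finrank ℂ E)) ℂ →ₗ[ℂ] ℂ :=
    φ ∘ₗ (LinearMap.applyₗ x) ∘ₗ e.symm.toLinearMap with hl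
  obtain ⟨K, hK0, hK⟩ := exists_norm_apply_le_mul_norm l
  have hlt : spectralRadius ℂ (e S) < ENNReal.ofReal ρ := by
    rw [← ENNReal.ofReal_toReal (spectralRadius_ne_top (e S)), hr]
    exact (ENNReal.ofReal_lt_ofReal_iff hρ0).mpr hρ
  have hev : ∀ᶠ q : ℕ in Filter.atTop, ‖e S ^ q‖ ≤ ρ ^ q := by
    filter_upwards [(spectrum.pow_nnnorm_pow_one_div_tendsto_nhds_spectralRadius
      (e S)).eventually_lt_const hlt, Filter.eventually_ge_atTop 1] with q hq hq1
    have hq0 : (q : ℝ) ≠ 0 := by positivity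
    have h1 := ENNReal.rpow_le_rpow hq.le (Nat.cast_nonneg q : (0 : ℝ) ≤ q)
    rw [← ENNReal.rpow_mul, one_div, inv_mul_cancel₀ hq0, ENNReal.rpow_one, ENNReal.rpow_natCast,
      ← ENNReal.ofReal_pow hρ0.le, ← enorm_eq_nnnorm, ← ofReal_norm] at h1
    exact (ENNReal.ofReal_le_ofReal_iff (by positivity)).mp h1
  obtain ⟨q₀, hq₀⟩ := Filter.eventually_atTop.mp hev
  set D : ℝ := 1 + ∑ q ∈ Finset.range q₀, ‖e S ^ q‖ / ρ ^ q with hD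
  have hsum : ∀ q ∈ Finset.range q₀, 0 ≤ ‖e S ^ q‖ / ρ ^ q := fun q _ => by positivity
  refine ⟨K * D, fun q => ?_⟩
  have h1 : ‖e S ^ q‖ ≤ D * ρ ^ q := by
    by_cases hq : q₀ ≤ q
    · refine (hq₀ q hq).trans (le_mul_of_one_le_left (by positivity) ?_)
      linarith [Finset.sum_nonneg hsum]
    · rw [← div_le_iff₀ (by positivity)]
      have := Finset.single_le_sum hsum (Finset.mem_range.mpr (not_le.mp hq))
      linarith
  have h2 : φ ((S ^ q) x) = l (e S ^ q) := by
    simp [hl, ← map_pow]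
  rw [h2, mul_assoc]
  exact (hK _).trans (by gcongr)

theorem exists_eigenvector_norm_eq_spectralRadius [Nontrivial E] (S : Module.End ℂ E) :
    ∃ (z : ℂ) (x : E), x ≠ 0 ∧ S x = z • x ∧ ‖z‖ = (spectralRadius ℂ S).toReal := by
  set b := Module.finBasis ℂ E
  set e := LinearMap.toMatrixAlgEquiv b
  have : CompleteSpace (Matrix (Fin (Module.finrank ℂ E)) (Fin (Module.finrank ℂ E)) ℂ) :=
    FiniteDimensional.complete ℂ _
  have hr : spectralRadius ℂ (e S) = spectralRadius ℂ S := by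
    simp only [spectralRadius, AlgEquiv.spectrum_eq]
  have hne : (spectrum ℂ (e S)).Nonempty := by
    rw [AlgEquiv.spectrum_eq]
    obtain ⟨z, hz⟩ := Module.End.exists_eigenvalue S
    exact ⟨z, hz.mem_spectrum⟩
  obtain ⟨z, hz, hzr⟩ := spectrum.exists_nnnorm_eq_spectralRadius_of_nonempty hne
  rw [AlgEquiv.spectrum_eq, ← Module.End.hasEigenvalue_iff_mem_spectrum] at hz
  obtain ⟨x, hx⟩ := hz.exists_hasEigenvector
  refine ⟨z, x, hx.2, hx.apply_eq_smul, ?_⟩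
  rw [← hr, ← hzr, ENNReal.coe_toReal, coe_nnnorm]

end FiniteDimensionalSpectrum

section ExtendedOperator

variable {d k m' : ℕ}

theorem windowCount_eq_zero {l : List (Fin k)} (hl : l.length ≤ m') : windowCount m' l = 0 := by
  induction l with
  | nil => rfl
  | cons a l ih =>
    ext w
    have h : ¬ List.ofFn w <+: a :: l := fun h => by
      have := h.length_le
      rw [List.length_ofFn] at this
      omega
    simp only [windowCount, if_neg h, ih (le_trans (by simp) hl), Pi.zero_apply, add_zero]

theorem dotProduct_windowCount_ofFn_append (t : (Fin (m' + 1) → Fin k) → ℝ)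
    (w : Fin (m' + 1) → Fin k) (l : List (Fin k)) :
    t ⬝ᵥ windowCount m' (List.ofFn w ++ l)
      = t w + t ⬝ᵥ windowCount m' (List.ofFn (Fin.tail w) ++ l) := by
  have h : ∀ u : Fin (m' + 1) → Fin k, List.ofFn u <+: List.ofFn w ++ l ↔ u = w := by
    refine fun u => ⟨fun h => ?_, fun h => h ▸ List.prefix_append _ _⟩
    have := List.prefix_of_prefix_length_le h (List.prefix_append _ _) (by simp)
    exact List.ofFn_injective (this.eq_of_length (by simp))
  have h' : windowCount m' (List.ofFn w ++ l)
      = Pi.single w 1 + windowCount m' (List.ofFn (Fin.tail w) ++ l) := by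
    ext u
    have h1 := h u
    rw [List.ofFn_succ (f := w), List.cons_append] at h1 ⊢
    simp only [windowCount, Pi.add_apply, Pi.single_apply]
    rw [if_congr h1 rfl rfl]
    rfl
  rw [h', dotProduct_add, dotProduct_single_one]

/-- The sum over continuations `j` of length `q` of the word `w` of the exponentially tilted
squared norms of the corresponding trajectories started in `v`. -/
noncomputable def tiltedMass (V : Fin k → Matrix (Fin d) (Fin d) ℂ)
    (t : (Fin (m' + 1) → Fin k) → ℝ) (q : ℕ) (w : Fin m' → Fin k) (v : Fin d → ℂ) : ℝ :=
  ∑ j : Fin q → Fin k, Real.exp (t ⬝ᵥ windowCount m' (List.ofFn w ++ List.ofFn j))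
    * normSqVec (listProd V (List.ofFn w ++ List.ofFn j) *ᵥ v)

theorem tiltedMass_zero (V : Fin k → Matrix (Fin d) (Fin d) ℂ)
    (t : (Fin (m' + 1) → Fin k) → ℝ) (w : Fin m' → Fin k) (v : Fin d → ℂ) :
    tiltedMass V t 0 w v = normSqVec (listProd V (List.ofFn w) *ᵥ v) := by
  simp [tiltedMass, windowCount_eq_zero]

theorem tiltedMass_succ (V : Fin k → Matrix (Fin d) (Fin d) ℂ)
    (t : (Fin (m' + 1) → Fin k) → ℝ) (q : ℕ) (w : Fin m' → Fin k) (v : Fin d → ℂ) :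
    tiltedMass V t (q + 1) w v = ∑ j : Fin k, Real.exp (t (Fin.snoc w j)) *
      tiltedMass V t q (Fin.tail (Fin.snoc w j : Fin (m' + 1) → Fin k))
        (V ((Fin.snoc w j : Fin (m' + 1) → Fin k) 0) *ᵥ v) := by
  rw [tiltedMass, sum_fin_succ_pi]
  refine Finset.sum_congr rfl fun j _ => ?_
  rw [tiltedMass, Finset.mul_sum]
  refine Finset.sum_congr rfl fun u _ => ?_
  have h : List.ofFn w ++ List.ofFn (Fin.cons j u : Fin (q + 1) → Fin k)
      = List.ofFn (Fin.snoc w j : Fin (m' + 1) → Fin k) ++ List.ofFn u := by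
    rw [List.ofFn_cons, List.ofFn_succ_last]
    simp
  rw [h, dotProduct_windowCount_ofFn_append, Real.exp_add, mul_assoc]
  congr 2
  rw [List.ofFn_succ, List.cons_append, listProd_cons, ← mulVec_mulVec]
  rfl

theorem dotProduct_extT_mulVec (V : Fin k → Matrix (Fin d) (Fin d) ℂ)
    (t : (Fin (m' + 1) → Fin k) → ℝ) (Y : (Fin m' → Fin k) → Matrix (Fin d) (Fin d) ℂ)
    (w : Fin m' → Fin k) (v : Fin d → ℂ) :
    star v ⬝ᵥ (extT V t Y w *ᵥ v) = ∑ j : Fin k, (Real.exp (t (Fin.snoc w j)) : ℂ) *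
      (star (V ((Fin.snoc w j : Fin (m' + 1) → Fin k) 0) *ᵥ v) ⬝ᵥ
        (Y (Fin.tail (Fin.snoc w j : Fin (m' + 1) → Fin k)) *ᵥ
          (V ((Fin.snoc w j : Fin (m' + 1) → Fin k) 0) *ᵥ v))) := by
  rw [extT, sum_mulVec, dotProduct_sum]
  refine Finset.sum_congr rfl fun j _ => ?_
  rw [smul_mulVec, dotProduct_smul, smul_eq_mul, star_mulVec, ← dotProduct_mulVec,
    mulVec_mulVec, mulVec_mulVec, Matrix.mul_assoc]

theorem dotProduct_extT_iterate_Mmat (V : Fin k → Matrix (Fin d) (Fin d) ℂ)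
    (t : (Fin (m' + 1) → Fin k) → ℝ) (q : ℕ) (w : Fin m' → Fin k) (v : Fin d → ℂ) :
    star v ⬝ᵥ ((extT V t)^[q] (Mmat V) w *ᵥ v) = (tiltedMass V t q w v : ℂ) := by
  induction q generalizing w v with
  | zero =>
    rw [tiltedMass_zero, ← star_dotProduct_self, star_mulVec, ← dotProduct_mulVec, mulVec_mulVec]
    rfl
  | succ q ih =>
    rw [Function.iterate_succ_apply', dotProduct_extT_mulVec, tiltedMass_succ, Complex.ofReal_sum]
    refine Finset.sum_congr rfl fun j _ => ?_
    rw [ih, Complex.ofReal_mul]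

theorem norm_dotProduct_extT_iterate_le (V : Fin k → Matrix (Fin d) (Fin d) ℂ)
    (t : (Fin (m' + 1) → Fin k) → ℝ) {Y : (Fin m' → Fin k) → Matrix (Fin d) (Fin d) ℂ} {C : ℝ}
    (hY : ∀ w v, ‖star v ⬝ᵥ (Y w *ᵥ v)‖ ≤ C * normSqVec (listProd V (List.ofFn w) *ᵥ v))
    (q : ℕ) (w : Fin m' → Fin k) (v : Fin d → ℂ) :
    ‖star v ⬝ᵥ ((extT V t)^[q] Y w *ᵥ v)‖ ≤ C * tiltedMass V t q w v := by
  induction q generalizing w v with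
  | zero => simpa only [tiltedMass_zero, Function.iterate_zero_apply] using hY w v
  | succ q ih =>
    rw [Function.iterate_succ_apply', dotProduct_extT_mulVec, tiltedMass_succ, Finset.mul_sum]
    refine norm_sum_le_of_le _ fun j _ => ?_
    rw [norm_mul, Complex.norm_real, Real.norm_of_nonneg (Real.exp_nonneg _), mul_left_comm]
    exact mul_le_mul_of_nonneg_left (ih _ _) (Real.exp_nonneg _)

/-- The moment generating function of the window counts. -/
theorem laplace_windowCount_eq (V : Fin k → Matrix (Fin d) (Fin d) ℂ) (ψ : Fin d → ℂ)
    (t : (Fin (m' + 1) → Fin k) → ℝ) (q : ℕ) :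
    laplace (Ω := fun n => Fin n → Fin k) (fun _ i => outProb V ψ i)
      (fun _ i => windowCount m' (List.ofFn i)) (m' + q) t = ∑ w, tiltedMass V t q w ψ := by
  rw [laplace, sum_fin_add_pi]
  refine Finset.sum_congr rfl fun w _ => Finset.sum_congr rfl fun j _ => ?_
  rw [outProb_eq, List.ofFn_fin_append, mul_comm]

end ExtendedOperator

section SpectralBounds

variable {d k m' : ℕ}

theorem eq_zero_of_forall_star_dotProduct_mulVec (A : Matrix (Fin d) (Fin d) ℂ)
    (h : ∀ v : Fin d → ℂ, star v ⬝ᵥ (A *ᵥ v) = 0) : A = 0 := by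
  have h0 : Matrix.toEuclideanLin A = 0 := by
    rw [← inner_map_self_eq_zero]
    intro x
    rw [← inner_conj_symm, EuclideanSpace.inner_eq_star_dotProduct, dotProduct_comm]
    have := h (WithLp.ofLp x)
    simp [Matrix.toLpLin_apply, this]
  simpa using h0

theorem exists_mulVec_eq_of_ker_le (P R : Matrix (Fin d) (Fin d) ℂ)
    (h : ∀ v, P *ᵥ v = 0 → R *ᵥ v = 0) :
    ∃ L : Matrix (Fin d) (Fin d) ℂ, ∀ v, R *ᵥ v = L *ᵥ (P *ᵥ v) := by
  have hker : LinearMap.ker P.mulVecLin ≤ LinearMap.ker R.mulVecLin := fun v hv => h v hv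
  obtain ⟨g, hg⟩ := LinearMap.exists_extend
    (((LinearMap.ker P.mulVecLin).liftQ R.mulVecLin hker) ∘ₗ
      P.mulVecLin.quotKerEquivRange.symm.toLinearMap)
  refine ⟨LinearMap.toMatrix' g, fun v => ?_⟩
  have h1 := LinearMap.congr_fun hg ⟨P.mulVecLin v, v, rfl⟩
  have h2 : P.mulVecLin.quotKerEquivRange.symm ⟨P.mulVecLin v, v, rfl⟩
      = Submodule.Quotient.mk v := by
    rw [LinearEquiv.symm_apply_eq]
    rfl
  simp only [LinearMap.comp_apply, LinearEquiv.coe_coe, h2] at h1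
  rw [LinearMap.toMatrix'_mulVec]
  exact h1.symm

theorem norm_star_dotProduct_mulVec_le (A : Matrix (Fin d) (Fin d) ℂ) (u : Fin d → ℂ) :
    ‖star u ⬝ᵥ (A *ᵥ u)‖ ≤ (∑ x, ∑ y, ‖A x y‖) * normSqVec u := by
  have hu : ∀ x y, ‖u x‖ * ‖u y‖ ≤ normSqVec u := fun x y => by
    have hx := Finset.single_le_sum (f := fun x => ‖u x‖ ^ 2) (fun _ _ => by positivity)
      (Finset.mem_univ x)
    have hy := Finset.single_le_sum (f := fun x => ‖u x‖ ^ 2) (fun _ _ => by positivity)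
      (Finset.mem_univ y)
    rw [normSqVec]
    nlinarith [sq_nonneg (‖u x‖ - ‖u y‖)]
  rw [dotProduct, Finset.sum_mul]
  refine norm_sum_le_of_le _ fun x _ => ?_
  rw [mulVec, dotProduct, Finset.mul_sum, Finset.sum_mul]
  refine norm_sum_le_of_le _ fun y _ => ?_
  rw [norm_mul, norm_mul, Pi.star_apply, norm_star]
  nlinarith [mul_le_mul_of_nonneg_left (hu x y) (norm_nonneg (A x y))]

/-- An element of the invariant subspace is dominated, as a quadratic form, by `Mmat`. -/
theorem exists_norm_le_of_mem_Bsub {V : Fin k → Matrix (Fin d) (Fin d) ℂ}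
    {Q : (Fin m' → Fin k) → Matrix (Fin d) (Fin d) ℂ}
    (hQherm : ∀ w, (Q w).IsHermitian)
    (hQker : ∀ w (v : Fin d → ℂ), Mmat V w *ᵥ v = 0 → Q w *ᵥ v = 0)
    {Y : (Fin m' → Fin k) → Matrix (Fin d) (Fin d) ℂ} (hY : Y ∈ Bsub Q) :
    ∃ C : ℝ, ∀ w v, ‖star v ⬝ᵥ (Y w *ᵥ v)‖ ≤ C * normSqVec (listProd V (List.ofFn w) *ᵥ v) := by
  have h : ∀ w, ∃ C : ℝ, 0 ≤ C ∧ ∀ v,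
      ‖star v ⬝ᵥ (Y w *ᵥ v)‖ ≤ C * normSqVec (listProd V (List.ofFn w) *ᵥ v) := by
    intro w
    obtain ⟨L, hL⟩ := exists_mulVec_eq_of_ker_le (listProd V (List.ofFn w)) (Q w) fun v hv => by
      refine hQker w v ?_
      have : Mmat V w = (listProd V (List.ofFn w))ᴴ * listProd V (List.ofFn w) := rfl
      rw [this, ← mulVec_mulVec, hv, mulVec_zero]
    refine ⟨∑ x, ∑ y, ‖(Lᴴ * Y w * L) x y‖, by positivity, fun v => ?_⟩
    refine le_trans (le_of_eq ?_) (norm_star_dotProduct_mulVec_le _ _)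
    congr 1
    calc star v ⬝ᵥ (Y w *ᵥ v) = star v ⬝ᵥ (((Q w)ᴴ * Y w * Q w) *ᵥ v) := by
          rw [(hQherm w).eq, ← hY w]
      _ = star (Q w *ᵥ v) ⬝ᵥ (Y w *ᵥ (Q w *ᵥ v)) := by
          rw [star_mulVec, ← dotProduct_mulVec, mulVec_mulVec, mulVec_mulVec, Matrix.mul_assoc]
      _ = star (L *ᵥ (listProd V (List.ofFn w) *ᵥ v)) ⬝ᵥ
            (Y w *ᵥ (L *ᵥ (listProd V (List.ofFn w) *ᵥ v))) := by rw [← hL]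
      _ = _ := by
          rw [star_mulVec L, ← dotProduct_mulVec, mulVec_mulVec _ (Y w), mulVec_mulVec _ Lᴴ,
            Matrix.mul_assoc]
  choose C hC0 hC using h
  refine ⟨∑ w, C w, fun w v => (hC w v).trans ?_⟩
  gcongr
  · exact normSqVec_nonneg _
  · exact Finset.single_le_sum (fun w _ => hC0 w) (Finset.mem_univ w)

theorem Mmat_mem_Bsub {V : Fin k → Matrix (Fin d) (Fin d) ℂ}
    {Q : (Fin m' → Fin k) → Matrix (Fin d) (Fin d) ℂ} (hQherm : ∀ w, (Q w).IsHermitian)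
    (hQrange : ∀ w, Q w * Mmat V w = Mmat V w) : Mmat V ∈ Bsub Q := by
  intro w
  have h := congrArg conjTranspose (hQrange w)
  have hM : (Mmat V w)ᴴ = Mmat V w := by simp [Mmat]
  rw [conjTranspose_mul, hM, (hQherm w).eq] at h
  rw [hQrange, h]

theorem Mmat_ne_zero {V : Fin k → Matrix (Fin d) (Fin d) ℂ} (hd : 1 ≤ d)
    (hnorm : ∑ i : Fin k, (V i)ᴴ * V i = 1) : Mmat (m' := m') V ≠ 0 := by
  intro h
  have : NeZero d := ⟨by omega⟩
  have h1 : (Tmap V)^[m'] 1 = 1 := Function.iterate_fixed (by simp [Tmap, hnorm]) m'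
  rw [Tmap_iterate] at h1
  have h2 : ∀ w : Fin m' → Fin k,
      (listProd V (List.ofFn w))ᴴ * 1 * listProd V (List.ofFn w) = 0 := fun w => by
    rw [Matrix.mul_one]
    exact congrFun h w
  rw [Finset.sum_eq_zero fun w _ => h2 w] at h1
  exact zero_ne_one h1

theorem coe_pow_apply {Q : (Fin m' → Fin k) → Matrix (Fin d) (Fin d) ℂ}
    {V : Fin k → Matrix (Fin d) (Fin d) ℂ} {t : (Fin (m' + 1) → Fin k) → ℝ}
    {S : Module.End ℂ (Bsub Q)}
    (hS : ∀ Y : Bsub Q, ((S Y : (Fin m' → Fin k) → Matrix (Fin d) (Fin d) ℂ)) = extT V t Y)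
    (q : ℕ) (Y : Bsub Q) :
    (((S ^ q) Y : Bsub Q) : (Fin m' → Fin k) → Matrix (Fin d) (Fin d) ℂ)
      = (extT V t)^[q] Y := by
  induction q with
  | zero => rfl
  | succ q ih => rw [pow_succ', Module.End.mul_apply, hS, ih, Function.iterate_succ_apply']

theorem exists_sum_tiltedMass_le {V : Fin k → Matrix (Fin d) (Fin d) ℂ}
    {Q : (Fin m' → Fin k) → Matrix (Fin d) (Fin d) ℂ} (hQherm : ∀ w, (Q w).IsHermitian)
    (hQrange : ∀ w, Q w * Mmat V w = Mmat V w) {t : (Fin (m' + 1) → Fin k) → ℝ}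
    {S : Module.End ℂ (Bsub Q)}
    (hS : ∀ Y : Bsub Q, ((S Y : (Fin m' → Fin k) → Matrix (Fin d) (Fin d) ℂ)) = extT V t Y)
    (ψ : Fin d → ℂ) {ρ : ℝ} (hρ : (spectralRadius ℂ S).toReal < ρ) :
    ∃ C : ℝ, ∀ q : ℕ, ∑ w, tiltedMass V t q w ψ ≤ C * ρ ^ q := by
  set φ : Bsub Q →ₗ[ℂ] ℂ :=
    { toFun := fun Y => ∑ w, star ψ ⬝ᵥ (Y.1 w *ᵥ ψ)
      map_add' := fun Y Z => by simp [add_mulVec, Finset.sum_add_distrib]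
      map_smul' := fun a Y => by simp [smul_mulVec, Finset.mul_sum] } with hφ
  obtain ⟨C, hC⟩ := exists_norm_apply_pow_le S φ ⟨Mmat V, Mmat_mem_Bsub hQherm hQrange⟩ hρ
  refine ⟨C, fun q => ?_⟩
  have h : φ ((S ^ q) ⟨Mmat V, Mmat_mem_Bsub hQherm hQrange⟩)
      = ((∑ w, tiltedMass V t q w ψ : ℝ) : ℂ) := by
    rw [hφ, LinearMap.coe_mk, AddHom.coe_mk, Complex.ofReal_sum]
    refine Finset.sum_congr rfl fun w _ => ?_
    rw [← dotProduct_extT_iterate_Mmat, coe_pow_apply hS]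
  have h1 := hC q
  rw [h, Complex.norm_real] at h1
  exact (le_abs_self _).trans h1

/-- The tilted Hilbert-Schmidt mass of all trajectories of length `n`. -/
noncomputable def tiltedNorm (V : Fin k → Matrix (Fin d) (Fin d) ℂ)
    (t : (Fin (m' + 1) → Fin k) → ℝ) (n : ℕ) : ℝ :=
  ∑ i : Fin n → Fin k, Real.exp (t ⬝ᵥ windowCount m' (List.ofFn i))
    * normSqMat (listProd V (List.ofFn i))

theorem tiltedMass_le_tiltedNorm (V : Fin k → Matrix (Fin d) (Fin d) ℂ)
    (t : (Fin (m' + 1) → Fin k) → ℝ) (q : ℕ) (w : Fin m' → Fin k) (v : Fin d → ℂ) :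
    tiltedMass V t q w v ≤ tiltedNorm V t (m' + q) * normSqVec v := by
  have h0 : ∀ w, 0 ≤ tiltedMass V t q w v := fun w =>
    Finset.sum_nonneg fun j _ => mul_nonneg (Real.exp_nonneg _) (normSqVec_nonneg _)
  refine (Finset.single_le_sum (f := fun w => tiltedMass V t q w v) (fun w _ => h0 w)
    (Finset.mem_univ w)).trans ?_
  rw [tiltedNorm, sum_fin_add_pi, Finset.sum_mul]
  refine Finset.sum_le_sum fun w _ => ?_
  rw [tiltedMass, Finset.sum_mul]
  refine Finset.sum_le_sum fun j _ => ?_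
  rw [List.ofFn_fin_append, mul_assoc]
  exact mul_le_mul_of_nonneg_left (normSqVec_mulVec_le _ _) (Real.exp_nonneg _)

theorem mul_tiltedNorm_le_laplace {V : Fin k → Matrix (Fin d) (Fin d) ℂ} {ψ : Fin d → ℂ}
    (hψ : normSqVec ψ = 1) {N : ℕ} {c : ℝ}
    (hc : ∀ (A : Matrix (Fin d) (Fin d) ℂ) (u : Fin d → ℂ),
      c * normSqMat A * normSqVec u
        ≤ ∑ g : Fin N → Fin k, normSqVec ((A * listProd V (List.ofFn g)) *ᵥ u))
    (t : (Fin (m' + 1) → Fin k) → ℝ) (n : ℕ) :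
    c * Real.exp (-((∑ w, |t w|) * (m' + N))) * tiltedNorm V t n
      ≤ laplace (Ω := fun n => Fin n → Fin k) (fun _ i => outProb V ψ i)
        (fun _ i => windowCount m' (List.ofFn i)) (N + n) t := by
  conv_rhs => rw [laplace, sum_fin_add_pi, Finset.sum_comm]
  rw [tiltedNorm, Finset.mul_sum]
  refine Finset.sum_le_sum fun i _ => ?_
  have h1 := hc (listProd V (List.ofFn i)) ψ
  rw [hψ, mul_one] at h1
  calc c * Real.exp (-((∑ w, |t w|) * (m' + N)))
        * (Real.exp (t ⬝ᵥ windowCount m' (List.ofFn i)) * normSqMat (listProd V (List.ofFn i)))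
      = c * normSqMat (listProd V (List.ofFn i)) *
        Real.exp (-((∑ w, |t w|) * (m' + N)) + t ⬝ᵥ windowCount m' (List.ofFn i)) := by
        rw [Real.exp_add]; ring
    _ ≤ (∑ g : Fin N → Fin k,
          normSqVec ((listProd V (List.ofFn i) * listProd V (List.ofFn g)) *ᵥ ψ)) *
        Real.exp (-((∑ w, |t w|) * (m' + N)) + t ⬝ᵥ windowCount m' (List.ofFn i)) := by
        gcongr
    _ ≤ _ := by
        rw [Finset.sum_mul]
        refine Finset.sum_le_sum fun g _ => ?_
        rw [outProb_eq, List.ofFn_fin_append, listProd_append]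
        refine mul_le_mul_of_nonneg_left (Real.exp_le_exp.mpr ?_) (normSqVec_nonneg _)
        have h2 := norm_windowCount_append_sub_le m' (List.ofFn g) (List.ofFn i)
        have h3 := norm_windowCount_le m' (List.ofFn g)
        rw [List.length_ofFn] at h3
        have h4 : ‖windowCount m' (List.ofFn i) - windowCount m' (List.ofFn g ++ List.ofFn i)‖
            ≤ m' + N := by
          have e : windowCount m' (List.ofFn i) - windowCount m' (List.ofFn g ++ List.ofFn i)
            = -(windowCount m' (List.ofFn g ++ List.ofFn i)
              - (windowCount m' (List.ofFn g) + windowCount m' (List.ofFn i)))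
              - windowCount m' (List.ofFn g) := by abel
          rw [e]
          refine (norm_sub_le _ _).trans ?_
          rw [norm_neg]
          linarith
        have h5 := (le_abs_self _).trans (abs_dotProduct_le t (windowCount m' (List.ofFn i)
          - windowCount m' (List.ofFn g ++ List.ofFn i)))
        rw [dotProduct_sub] at h5
        have h6 : (∑ w, |t w|) * ‖windowCount m' (List.ofFn i)
            - windowCount m' (List.ofFn g ++ List.ofFn i)‖ ≤ (∑ w, |t w|) * (m' + N) := by
          gcongr
        linarith

theorem exists_mul_pow_le_laplace {V : Fin k → Matrix (Fin d) (Fin d) ℂ} (hd : 1 ≤ d)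
    (hnorm : ∑ i : Fin k, (V i)ᴴ * V i = 1)
    {Q : (Fin m' → Fin k) → Matrix (Fin d) (Fin d) ℂ} (hQherm : ∀ w, (Q w).IsHermitian)
    (hQrange : ∀ w, Q w * Mmat V w = Mmat V w)
    (hQker : ∀ w (v : Fin d → ℂ), Mmat V w *ᵥ v = 0 → Q w *ᵥ v = 0)
    {t : (Fin (m' + 1) → Fin k) → ℝ} {S : Module.End ℂ (Bsub Q)}
    (hS : ∀ Y : Bsub Q, ((S Y : (Fin m' → Fin k) → Matrix (Fin d) (Fin d) ℂ)) = extT V t Y)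
    {ψ : Fin d → ℂ} (hψ : normSqVec ψ = 1) {N : ℕ} {c : ℝ} (hc0 : 0 < c)
    (hc : ∀ (A : Matrix (Fin d) (Fin d) ℂ) (u : Fin d → ℂ),
      c * normSqMat A * normSqVec u
        ≤ ∑ g : Fin N → Fin k, normSqVec ((A * listProd V (List.ofFn g)) *ᵥ u)) :
    ∃ b : ℝ, 0 < b ∧ ∀ q : ℕ, b * (spectralRadius ℂ S).toReal ^ q
      ≤ laplace (Ω := fun n => Fin n → Fin k) (fun _ i => outProb V ψ i)
        (fun _ i => windowCount m' (List.ofFn i)) (N + m' + q) t := by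
  have : Nontrivial (Bsub Q) := by
    refine ⟨⟨Mmat V, Mmat_mem_Bsub hQherm hQrange⟩, 0, fun h => ?_⟩
    exact Mmat_ne_zero hd hnorm (congrArg Subtype.val h)
  obtain ⟨z, Y, hY0, hYz, hz⟩ := exists_eigenvector_norm_eq_spectralRadius S
  obtain ⟨C, hC⟩ := exists_norm_le_of_mem_Bsub hQherm hQker Y.2
  obtain ⟨w, v, hwv⟩ : ∃ w v, star v ⬝ᵥ (Y.1 w *ᵥ v) ≠ 0 := by
    by_contra! h
    exact hY0 (Subtype.ext (funext fun w => eq_zero_of_forall_star_dotProduct_mulVec _ (h w)))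
  set a := ‖star v ⬝ᵥ (Y.1 w *ᵥ v)‖ with ha
  have ha0 : 0 < a := norm_pos_iff.mpr hwv
  set D : ℝ := |C| * normSqVec v + 1 with hD
  have hD0 : 0 < D := by have := normSqVec_nonneg v; positivity
  set e := Real.exp (-((∑ w, |t w|) * (m' + N))) with he
  have he0 : 0 < e := Real.exp_pos _
  refine ⟨c * e * (a / D), by positivity, fun q => ?_⟩
  have hpow : (S ^ q) Y = z ^ q • Y := by
    induction q with
    | zero => simp
    | succ q ih => rw [pow_succ', Module.End.mul_apply, ih, map_smul, hYz, smul_smul, pow_succ]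
  have hZ0 : 0 ≤ tiltedNorm V t (m' + q) :=
    Finset.sum_nonneg fun i _ => mul_nonneg (Real.exp_nonneg _) (normSqMat_nonneg _)
  have hle : a * (spectralRadius ℂ S).toReal ^ q ≤ tiltedNorm V t (m' + q) * D := by
    have h1 := norm_dotProduct_extT_iterate_le V t hC q w v
    rw [← coe_pow_apply hS, hpow, Submodule.coe_smul, Pi.smul_apply, smul_mulVec,
      dotProduct_smul, smul_eq_mul, norm_mul, norm_pow, hz, ← ha] at h1
    have h2 := tiltedMass_le_tiltedNorm V t q w v
    have h3 : 0 ≤ tiltedMass V t q w v :=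
      Finset.sum_nonneg fun j _ => mul_nonneg (Real.exp_nonneg _) (normSqVec_nonneg _)
    calc a * (spectralRadius ℂ S).toReal ^ q ≤ C * tiltedMass V t q w v := by
          rw [mul_comm]; exact h1
      _ ≤ |C| * tiltedMass V t q w v := by gcongr; exact le_abs_self C
      _ ≤ |C| * (tiltedNorm V t (m' + q) * normSqVec v) := by gcongr
      _ ≤ tiltedNorm V t (m' + q) * D := by rw [hD]; nlinarith
  have h4 := mul_tiltedNorm_le_laplace hψ hc t (m' + q)
  rw [← add_assoc] at h4
  refine le_trans ?_ h4
  rw [mul_assoc]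
  refine mul_le_mul_of_nonneg_left ?_ (by positivity)
  rw [div_mul_eq_mul_div, div_le_iff₀ hD0]
  exact hle

theorem exp_neg_le_laplace {V : Fin k → Matrix (Fin d) (Fin d) ℂ}
    (hnorm : ∑ i : Fin k, (V i)ᴴ * V i = 1) {ψ : Fin d → ℂ} (hψ : normSqVec ψ = 1)
    (t : (Fin (m' + 1) → Fin k) → ℝ) (n : ℕ) :
    Real.exp (-((∑ w, |t w|) * n))
      ≤ laplace (Ω := fun n => Fin n → Fin k) (fun _ i => outProb V ψ i)
        (fun _ i => windowCount m' (List.ofFn i)) n t := by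
  rw [laplace, ← one_mul (Real.exp _), ← sum_outProb hnorm hψ n, Finset.sum_mul]
  refine Finset.sum_le_sum fun i _ => ?_
  refine mul_le_mul_of_nonneg_left (Real.exp_le_exp.mpr ?_) (outProb_nonneg _ _ _)
  have h1 := norm_windowCount_le m' (List.ofFn i)
  rw [List.length_ofFn] at h1
  have h2 := (abs_le.mp (abs_dotProduct_le t (windowCount m' (List.ofFn i)))).1
  have h3 : (∑ w, |t w|) * ‖windowCount m' (List.ofFn i)‖ ≤ (∑ w, |t w|) * n := by gcongr
  linarith

theorem pos_of_forall_exists_le_mul_pow {f : ℕ → ℝ} {a : ℕ} {r T : ℝ} (hr : 0 ≤ r)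
    (hlow : ∀ n : ℕ, Real.exp (-(T * n)) ≤ f n)
    (hup : ∀ ρ : ℝ, r < ρ → ∃ C, ∀ q, f (a + q) ≤ C * ρ ^ q) : 0 < r := by
  refine hr.lt_of_ne' fun h0 => ?_
  subst h0
  obtain ⟨C, hC⟩ := hup (Real.exp (-T - 1)) (Real.exp_pos _)
  have h1 : ∀ q : ℕ, Real.exp q ≤ C * Real.exp (T * a) := fun q => by
    have h2 := (hlow (a + q)).trans (hC q)
    rw [← Real.exp_nat_mul] at h2
    have h3 := mul_le_mul_of_nonneg_right h2 (Real.exp_nonneg (T * a + (T + 1) * q))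
    rw [← Real.exp_add, mul_assoc, ← Real.exp_add] at h3
    refine le_of_eq_of_le ?_ (h3.trans (le_of_eq ?_))
    · congr 1; push_cast; ring
    · congr 2; ring
  obtain ⟨q, hq⟩ := exists_nat_gt (C * Real.exp (T * a))
  have := Real.add_one_le_exp (q : ℝ)
  linarith [h1 q]

theorem eventually_le_exp {f : ℕ → ℝ} {a : ℕ} {r : ℝ} (hr : 0 < r)
    (hup : ∀ ρ : ℝ, r < ρ → ∃ C, ∀ q, f (a + q) ≤ C * ρ ^ q) {ε : ℝ} (hε : 0 < ε) :
    ∀ᶠ n : ℕ in Filter.atTop, f n ≤ Real.exp (n * (Real.log r + ε)) := by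
  obtain ⟨C, hC⟩ := hup (r * Real.exp (ε / 2)) (by
    have := Real.one_lt_exp_iff.mpr (half_pos hε)
    nlinarith)
  set ρ := r * Real.exp (ε / 2) with hρ
  have hρ0 : 0 < ρ := by positivity
  have hlim : Filter.Tendsto (fun n : ℕ => Real.exp (n * (ε / 2))) Filter.atTop Filter.atTop :=
    Real.tendsto_exp_atTop.comp
      (tendsto_natCast_atTop_atTop.atTop_mul_const (half_pos hε))
  filter_upwards [hlim.eventually_ge_atTop (C / ρ ^ a), Filter.eventually_ge_atTop a] with n hn ha
  obtain ⟨q, rfl⟩ := Nat.exists_eq_add_of_le ha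
  refine (hC q).trans ?_
  have e : Real.exp ((a + q : ℕ) * (Real.log r + ε))
      = ρ ^ (a + q) * Real.exp ((a + q : ℕ) * (ε / 2)) := by
    rw [hρ, ← Real.exp_log hr, ← Real.exp_add, ← Real.exp_nat_mul, ← Real.exp_add, Real.log_exp]
    congr 1
    ring
  rw [e, pow_add]
  rw [div_le_iff₀ (by positivity)] at hn
  nlinarith [pow_pos hρ0 q]

theorem eventually_exp_le {f : ℕ → ℝ} {a : ℕ} {r b : ℝ} (hr : 0 < r) (hb : 0 < b)
    (hlow : ∀ q : ℕ, b * r ^ q ≤ f (a + q)) {ε : ℝ} (hε : 0 < ε) :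
    ∀ᶠ n : ℕ in Filter.atTop, Real.exp (n * (Real.log r - ε)) ≤ f n := by
  have hlim : Filter.Tendsto (fun n : ℕ => Real.exp (n * ε)) Filter.atTop Filter.atTop :=
    Real.tendsto_exp_atTop.comp (tendsto_natCast_atTop_atTop.atTop_mul_const hε)
  filter_upwards [hlim.eventually_ge_atTop (r ^ a / b), Filter.eventually_ge_atTop a] with n hn ha
  obtain ⟨q, rfl⟩ := Nat.exists_eq_add_of_le ha
  refine le_trans ?_ (hlow q)
  have e : Real.exp ((a + q : ℕ) * (Real.log r - ε)) * Real.exp ((a + q : ℕ) * ε)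
      = r ^ a * r ^ q := by
    rw [← pow_add, ← Real.exp_add, ← mul_add, sub_add_cancel, Real.exp_nat_mul, Real.exp_log hr]
  rw [div_le_iff₀ hb] at hn
  have h1 := mul_le_mul_of_nonneg_right hn (pow_nonneg hr.le q)
  rw [← e] at h1
  have h2 := Real.exp_pos ((a + q : ℕ) * ε)
  refine le_of_mul_le_mul_right ?_ h2
  linarith

end SpectralBounds

section EmpiricalMeasure

variable {d k m' : ℕ}

theorem windowCount_eq_sum_range (l : List (Fin k)) (w : Fin (m' + 1) → Fin k) :
    windowCount m' l w
      = ∑ j ∈ Finset.range l.length, if List.ofFn w <+: l.drop j then 1 else 0 := by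
  induction l with
  | nil => rfl
  | cons a l ih =>
    rw [List.length_cons, Finset.sum_range_succ', add_comm]
    simp only [windowCount, ih, List.drop_succ_cons, List.drop_zero]

theorem ofFn_isPrefix_drop_ofFn_iff {n : ℕ} (i : Fin n → Fin k) (w : Fin (m' + 1) → Fin k)
    {j : ℕ} (hj : j < n - m') :
    List.ofFn w <+: (List.ofFn i).drop j ↔
      (fun l : Fin (m' + 1) => i ⟨j + l.1, by have hl := l.2; omega⟩) = w := by
  constructor
  · intro h
    ext1 l
    have := h.getElem (i := l.1) (by simpa using l.is_le)
    simpa [-List.ofFn_succ] using this.symm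
  · rintro rfl
    rw [List.prefix_iff_eq_take]
    refine List.ext_getElem ?_ fun a h1 h2 => ?_
    · simp; omega
    · simp [-List.ofFn_succ]

theorem sum_window_eq_windowCount {n : ℕ} (i : Fin n → Fin k) (w : Fin (m' + 1) → Fin k) :
    (∑ j : Fin (n - m'), if (fun l : Fin (m' + 1) =>
        i ⟨j.1 + l.1, by have hj := j.2; have hl := l.2; omega⟩) = w then (1 : ℝ) else 0)
      = windowCount m' (List.ofFn i) w := by
  rw [windowCount_eq_sum_range, List.length_ofFn]
  calc _ = ∑ j : Fin (n - m'), if List.ofFn w <+: (List.ofFn i).drop j.1 then (1 : ℝ) else 0 :=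
        Finset.sum_congr rfl fun j _ =>
          if_congr (ofFn_isPrefix_drop_ofFn_iff i w j.2).symm rfl rfl
    _ = ∑ j ∈ Finset.range (n - m'),
          if List.ofFn w <+: (List.ofFn i).drop j then (1 : ℝ) else 0 :=
        Fin.sum_univ_eq_sum_range
          (fun j => if List.ofFn w <+: (List.ofFn i).drop j then (1 : ℝ) else 0) (n - m')
    _ = _ := by
        refine Finset.sum_subset (Finset.range_mono (Nat.sub_le _ _)) fun j hj hj' => if_neg ?_
        intro h
        have := h.length_le
        simp only [List.length_ofFn, List.length_drop, Finset.mem_range] at this hj hj'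
        omega

theorem empMeas_eq {n : ℕ} (i : Fin n → Fin k) :
    empMeas (m' := m') n i = ((n - m' : ℕ) : ℝ)⁻¹ • windowCount m' (List.ofFn i) := by
  ext w
  rw [Pi.smul_apply, smul_eq_mul, ← sum_window_eq_windowCount]
  rfl

theorem norm_empMeas_le_one {n : ℕ} (i : Fin n → Fin k) : ‖empMeas (m' := m') n i‖ ≤ 1 := by
  rw [pi_norm_le_iff_of_nonneg zero_le_one]
  intro w
  have h0 : 0 ≤ windowCount m' (List.ofFn i) w := windowCount_nonneg _ _ _
  have h1 : windowCount m' (List.ofFn i) w ≤ ((n - m' : ℕ) : ℝ) := by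
    rw [← sum_window_eq_windowCount]
    refine (Finset.sum_le_card_nsmul _ _ (1 : ℝ) fun j _ => ?_).trans (by simp)
    split_ifs <;> norm_num
  rw [empMeas_eq, Pi.smul_apply, smul_eq_mul, Real.norm_of_nonneg (by positivity)]
  rcases (Nat.cast_nonneg (n - m') : (0 : ℝ) ≤ _).eq_or_lt with h | h
  · rw [← h]; simp
  · rw [inv_mul_le_iff₀ h, mul_one]
    exact h1

theorem norm_smul_empMeas_sub_le {n : ℕ} (hn : m' < n) (i : Fin n → Fin k) :
    ‖(n : ℝ) • empMeas (m' := m') n i - windowCount m' (List.ofFn i)‖ ≤ m' := by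
  have h : ((n - m' : ℕ) : ℝ) ≠ 0 := by
    have : n - m' ≠ 0 := by omega
    exact_mod_cast this
  have h1 : windowCount m' (List.ofFn i) = ((n - m' : ℕ) : ℝ) • empMeas (m' := m') n i := by
    rw [empMeas_eq, smul_smul, mul_inv_cancel₀ h, one_smul]
  rw [h1, ← sub_smul, Nat.cast_sub hn.le, sub_sub_cancel, norm_smul, Real.norm_natCast]
  exact mul_le_of_le_one_right (by positivity) (norm_empMeas_le_one i)

theorem inv_mul_log_le {n : ℕ} (hn : n ≠ 0) {y b : ℝ} (h : y ≤ Real.exp (-(n * b))) :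
    (((n : ℝ)⁻¹ : ℝ) : EReal) * ENNReal.log (ENNReal.ofReal y) ≤ ((-b : ℝ) : EReal) := by
  have h1 : ENNReal.log (ENNReal.ofReal y) ≤ ((-(n * b) : ℝ) : EReal) := by
    rw [← Real.log_exp (-(n * b)), ← ENNReal.log_ofReal_of_pos (Real.exp_pos _)]
    exact ENNReal.log_monotone (ENNReal.ofReal_le_ofReal h)
  refine (mul_le_mul_of_nonneg_left h1 (EReal.coe_nonneg.mpr (by positivity))).trans ?_
  rw [← EReal.coe_mul]
  refine le_of_eq (congrArg _ ?_)
  field_simp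

theorem le_inv_mul_log {n : ℕ} (hn : n ≠ 0) {y a : ℝ} (h : Real.exp (-(n * a)) ≤ y) :
    ((-a : ℝ) : EReal) ≤ (((n : ℝ)⁻¹ : ℝ) : EReal) * ENNReal.log (ENNReal.ofReal y) := by
  have h1 : ((-(n * a) : ℝ) : EReal) ≤ ENNReal.log (ENNReal.ofReal y) := by
    rw [← Real.log_exp (-(n * a)), ← ENNReal.log_ofReal_of_pos (Real.exp_pos _)]
    exact ENNReal.log_monotone (ENNReal.ofReal_le_ofReal h)
  refine le_trans ?_ (mul_le_mul_of_nonneg_left h1 (EReal.coe_nonneg.mpr (by positivity)))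
  rw [← EReal.coe_mul]
  refine le_of_eq (congrArg _ ?_)
  field_simp

theorem empProb_mono {V : Fin k → Matrix (Fin d) (Fin d) ℂ} {ψ : Fin d → ℂ} {n : ℕ}
    {B B' : Set ((Fin (m' + 1) → Fin k) → ℝ)} (h : B ⊆ B') :
    empProb V ψ n B ≤ empProb V ψ n B' := by
  refine Finset.sum_le_sum fun i _ => ?_
  split_ifs with h1 h2
  · exact le_rfl
  · exact absurd (h h1) h2
  · exact outProb_nonneg _ _ _
  · exact le_rfl

theorem eventually_exp_le_empProb {V : Fin k → Matrix (Fin d) (Fin d) ℂ} {ψ : Fin d → ℂ}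
    {B : Set ((Fin (m' + 1) → Fin k) → ℝ)} {x : (Fin (m' + 1) → Fin k) → ℝ} {a : ℝ}
    (hx : x ∈ interior B)
    (h : (x, a) ∈ rateSet (nearMass (Ω := fun n => Fin n → Fin k) (fun _ i => outProb V ψ i)
      (fun _ i => windowCount m' (List.ofFn i)))) {ε : ℝ} (hε : 0 < ε) :
    ∀ᶠ n : ℕ in Filter.atTop, Real.exp (-(n * (a + ε))) ≤ empProb V ψ n B := by
  obtain ⟨δ, hδ, hball⟩ := Metric.isOpen_iff.mp isOpen_interior x hx
  filter_upwards [h (δ / 3) (by positivity) ε hε,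
    (tendsto_natCast_atTop_atTop.atTop_mul_const (by positivity : 0 < δ / 3)).eventually_ge_atTop
      (m' : ℝ), Filter.eventually_gt_atTop m'] with n hn hm hnm
  refine hn.trans (Finset.sum_le_sum fun i _ => ?_)
  have hn0 : (0 : ℝ) < n := by exact_mod_cast (Nat.zero_le _).trans_lt hnm
  split_ifs with h1 h2
  · exact le_rfl
  · refine absurd (interior_subset (hball ?_)) h2
    rw [Metric.mem_ball, dist_eq_norm]
    have h3 := norm_smul_empMeas_sub_le hnm i
    have e : (n : ℝ) • (empMeas (m' := m') n i - x)
        = ((n : ℝ) • empMeas (m' := m') n i - windowCount m' (List.ofFn i))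
          + (windowCount m' (List.ofFn i) - (n : ℝ) • x) := by
      rw [smul_sub]; abel
    have h4 : (n : ℝ) * ‖empMeas (m' := m') n i - x‖ ≤ n * (δ / 3) + n * (δ / 3) := by
      rw [← Real.norm_natCast n, ← norm_smul, Real.norm_natCast, e]
      exact (norm_add_le _ _).trans (add_le_add (h3.trans hm) h1)
    nlinarith
  · exact outProb_nonneg _ _ _
  · exact le_rfl

end EmpiricalMeasure

/-- **Sanov theorem for quantum Markov chains.** If the transition operator is primitive, the
level-`m` empirical measure of the output process satisfies a large deviations principle with
rate function `I(x) = sup_t (⟨t, x⟩ − log r(T̃_{t,m}))`, where `T̃_{t,m}` is the restriction of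
the extended transition operator to the invariant subspace `B_m`. -/
theorem sanov_quantum_markov_chain {d k m' : ℕ} (hd : 1 ≤ d) (hk : 1 ≤ k)
    (V : Fin k → Matrix (Fin d) (Fin d) ℂ)
    (hnorm : ∑ i : Fin k, (V i)ᴴ * V i = 1)
    -- the transition operator is primitive
    (hprim : ∃ n : ℕ, ∀ A : Matrix (Fin d) (Fin d) ℂ,
      A.PosSemidef → A ≠ 0 → ((Tmap V)^[n] A).PosDef)
    -- `ψ` is a unit vector
    (ψ : Fin d → ℂ) (hψ : ∑ x : Fin d, ‖ψ x‖ ^ 2 = 1)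
    -- `Q_w` is the orthogonal projection onto the range of `[M^{(m)}]_w`
    (Q : (Fin m' → Fin k) → Matrix (Fin d) (Fin d) ℂ)
    (hQherm : ∀ w, (Q w).IsHermitian)
    (hQidem : ∀ w, Q w * Q w = Q w)
    (hQrange : ∀ w, Q w * Mmat V w = Mmat V w)
    (hQker : ∀ w (v : Fin d → ℂ), Mmat V w *ᵥ v = 0 → Q w *ᵥ v = 0)
    -- `S t` is the restriction `T̃_{t,m}` of `T_{t,m}` to `B_m`
    (S : ((Fin (m' + 1) → Fin k) → ℝ) → Module.End ℂ ↥(Bsub Q))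
    (hS : ∀ t (Y : ↥(Bsub Q)), ((S t Y : (Fin m' → Fin k) → Matrix (Fin d) (Fin d) ℂ))
      = extT V t (Y : (Fin m' → Fin k) → Matrix (Fin d) (Fin d) ℂ))
    -- the rate function `I(x) = sup_t (⟨t, x⟩ − log r(T̃_{t,m}))`, with values in `[0, ∞]`
    (I : ((Fin (m' + 1) → Fin k) → ℝ) → EReal)
    (hI : ∀ x, I x = ⨆ t : (Fin (m' + 1) → Fin k) → ℝ,
      (((∑ w, t w * x w) - Real.log ((spectralRadius ℂ (S t)).toReal) : ℝ) : EReal)) :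
    ∀ B : Set ((Fin (m' + 1) → Fin k) → ℝ), MeasurableSet B →
      (-(⨅ x ∈ interior B, I x) ≤
          Filter.liminf (fun n : ℕ =>
            (((n : ℝ)⁻¹ : ℝ) : EReal) * ENNReal.log (ENNReal.ofReal (empProb V ψ n B)))
            Filter.atTop) ∧
      (Filter.limsup (fun n : ℕ =>
            (((n : ℝ)⁻¹ : ℝ) : EReal) * ENNReal.log (ENNReal.ofReal (empProb V ψ n B)))
            Filter.atTop ≤ -(⨅ x ∈ closure B, I x)) := by
  obtain ⟨N, hN⟩ := hprim
  obtain ⟨c, hc0, hc1, hc⟩ := exists_connecting_constant hN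
  have hψ' : normSqVec ψ = 1 := hψ
  set p : ∀ n : ℕ, (Fin n → Fin k) → ℝ := fun _ i => outProb V ψ i with hp
  set X : ∀ n : ℕ, (Fin n → Fin k) → (Fin (m' + 1) → Fin k) → ℝ :=
    fun _ i => windowCount m' (List.ofFn i) with hX
  have hp0 : ∀ n i, 0 ≤ p n i := fun _ i => outProb_nonneg V ψ i
  have hXn : ∀ n i, ‖X n i‖ ≤ n := fun n i => by
    simpa only [List.length_ofFn] using norm_windowCount_le m' (List.ofFn i)
  have hup : ∀ t ρ, (spectralRadius ℂ (S t)).toReal < ρ →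
      ∃ C, ∀ q, laplace p X (m' + q) t ≤ C * ρ ^ q := fun t ρ hρ => by
    obtain ⟨C, hC⟩ := exists_sum_tiltedMass_le hQherm hQrange (hS t) ψ hρ
    exact ⟨C, fun q => (laplace_windowCount_eq V ψ t q).le.trans (hC q)⟩
  have hpos : ∀ t, 0 < (spectralRadius ℂ (S t)).toReal := fun t =>
    pos_of_forall_exists_le_mul_pow ENNReal.toReal_nonneg (exp_neg_le_laplace hnorm hψ' t) (hup t)
  set Λ : ((Fin (m' + 1) → Fin k) → ℝ) → ℝ :=
    fun t => Real.log (spectralRadius ℂ (S t)).toReal with hΛ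
  have hupper : ∀ t, ∀ ε > 0, ∀ᶠ n : ℕ in Filter.atTop,
      laplace p X n t ≤ Real.exp (n * (Λ t + ε)) :=
    fun t ε hε => eventually_le_exp (hpos t) (hup t) hε
  have hlower : ∀ t, ∀ ε > 0, ∀ᶠ n : ℕ in Filter.atTop,
      Real.exp (n * (Λ t - ε)) ≤ laplace p X n t := fun t ε hε => by
    obtain ⟨b, hb, hle⟩ :=
      exists_mul_pow_le_laplace hd hnorm hQherm hQrange hQker (hS t) hψ' hc0 hc
    exact eventually_exp_le (hpos t) hb hle hε
  have hsup : IsSupermultiplicative (nearMass p X) c N (2 * m' + N) :=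
    isSupermultiplicative_nearMass m' hnorm hψ' hc0 hc1 hc
  have hI_le : ∀ x t, ((t ⬝ᵥ x - Λ t : ℝ) : EReal) ≤ I x := fun x t => by
    rw [hI]
    exact le_iSup (fun t : (Fin (m' + 1) → Fin k) → ℝ =>
      (((∑ w, t w * x w) - Real.log ((spectralRadius ℂ (S t)).toReal) : ℝ) : EReal)) t
  intro B _
  constructor
  · rw [EReal.neg_le]
    refine le_iInf₂ fun x hx => ?_
    rw [EReal.neg_le]
    induction hIx : I x with
    | bot => exact absurd (hIx ▸ hI_le x 0) (by simp)
    | top => simp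
    | coe a =>
      have hmem : (x, a) ∈ rateSet (nearMass p X) :=
        mem_rateSet_of_forall_le hp0 hXn hsup hlower fun t => by
          have := hI_le x t
          rw [hIx] at this
          exact_mod_cast this
      refine le_of_forall_lt_imp_le_of_dense fun s hs => ?_
      obtain ⟨s', hs', hs''⟩ := EReal.lt_iff_exists_real_btwn.mp hs
      have hlt : s' < -a := by exact_mod_cast hs''
      refine hs'.le.trans (Filter.le_liminf_of_le (by isBoundedDefault) ?_)
      filter_upwards [eventually_exp_le_empProb hx hmem (by linarith : 0 < -a - s'),
        Filter.eventually_ne_atTop 0] with n hn hn0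
      have := le_inv_mul_log hn0 hn
      rwa [show -(a + (-a - s')) = s' by ring] at this
  · rw [EReal.le_neg]
    refine le_of_forall_lt_imp_le_of_dense fun s hs => ?_
    obtain ⟨b', hsb', hb'⟩ := EReal.lt_iff_exists_real_btwn.mp hs
    obtain ⟨b, hb'b, hb⟩ := EReal.lt_iff_exists_real_btwn.mp hb'
    refine hsb'.le.trans ?_
    rw [EReal.le_neg]
    have hex : ∀ x ∈ closure B, ∃ t, b < t ⬝ᵥ x - Λ t := fun x hx => by
      have := hb.trans_le (iInf₂_le x hx)
      rw [hI, lt_iSup_iff] at this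
      obtain ⟨t, ht⟩ := this
      exact ⟨t, by exact_mod_cast ht⟩
    have hev := eventually_mass_le (Z := fun n i => empMeas (m' := m') n i) (C := m') hp0 hupper
      (fun n i => norm_empMeas_le_one i)
      ((Filter.eventually_gt_atTop m').mono fun n hn i => norm_smul_empMeas_sub_le hn i)
      isClosed_closure (b := b) (b' := b') (by exact_mod_cast hb'b) hex
    refine Filter.limsup_le_of_le (by isBoundedDefault) ?_
    filter_upwards [hev, Filter.eventually_ne_atTop 0] with n hn hn0
    exact inv_mul_log_le hn0 ((empProb_mono subset_closure).trans hn)
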